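/- arXiv:1603.07720 — 7 statements merged into one kernel-verified Lean document; each statement's English description precedes it below -/
import Mathlib

section
/- There exist a measure preserving system (X, 𝒳, μ, T) that is mixing, and sets A, B ∈ 𝒳 with 0 < μ(A) < 1 and 0 < μ(B) < 1, such that μ(A ∩ T⁻ⁿA) < μ(A)² for every n ≥ 1 (A is strictly under-recurrent) and μ(B ∩ T⁻ⁿB) > μ(B)² for every n ≥ 1 (B is strictly over-recurrent). -/
open MeasureTheory Filter Topology

/-- The doubling map `x ↦ 2x mod 1`, as a map on the real line. -/
noncomputable def doublingMap (x : ℝ) : ℝ := Int.fract (2 * x)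

/-- Lebesgue measure on `[0, 1)`, as a measure on the real line. -/
noncomputable def unitMeasure : Measure ℝ := volume.restrict (Set.Ico 0 1)

/-- The Lebesgue measure of the part of `C` lying in `[0, x)`. -/
noncomputable def initialMass (C : Set ℝ) (x : ℝ) : ℝ := volume.real (Set.Ico 0 x ∩ C)

/-- The amount by which the mass of `C` in `[0, x)` exceeds the one expected from the
mass of `C` in `[0, 1)`. -/
noncomputable def discrepancy (C : Set ℝ) (x : ℝ) : ℝ := initialMass C x - x * initialMass C 1

instance : IsProbabilityMeasure unitMeasure := ⟨by simp [unitMeasure]⟩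

lemma measurable_doublingMap : Measurable doublingMap :=
  measurable_fract.comp (measurable_const_mul 2)

lemma doublingMap_of_lt_half {x : ℝ} (h₀ : 0 ≤ x) (h₁ : x < 1 / 2) : doublingMap x = 2 * x :=
  Int.fract_eq_self.2 ⟨by linarith, by linarith⟩

lemma doublingMap_of_half_le {x : ℝ} (h₀ : 1 / 2 ≤ x) (h₁ : x < 1) :
    doublingMap x = 2 * x - 1 := by
  rw [doublingMap, Int.fract_eq_iff]
  exact ⟨by linarith, by linarith, 1, by norm_num⟩

lemma doublingMap_mem_Ico (x : ℝ) : doublingMap x ∈ Set.Ico (0 : ℝ) 1 :=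
  ⟨Int.fract_nonneg _, Int.fract_lt_one _⟩

lemma volume_real_preimage_two_mul (S : Set ℝ) :
    volume.real ((fun y : ℝ => 2 * y) ⁻¹' S) = volume.real S / 2 := by
  rw [measureReal_def, Real.volume_preimage_mul_left two_ne_zero]
  simp [measureReal_def]
  ring

lemma volume_real_preimage_two_mul_sub_one (S : Set ℝ) :
    volume.real ((fun y : ℝ => 2 * y - 1) ⁻¹' S) = volume.real S / 2 := by
  have h : (fun y : ℝ => 2 * y - 1) ⁻¹' S = (fun y : ℝ => 2 * y) ⁻¹' ((fun z => z + (-1)) ⁻¹' S) := by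
    ext y; simp [sub_eq_add_neg]
  rw [h, volume_real_preimage_two_mul, measureReal_def, measure_preimage_add_right,
    measureReal_def]

lemma initialMass_preimage_of_lt_half (C : Set ℝ) {x : ℝ} (h : x < 1 / 2) :
    initialMass (doublingMap ⁻¹' C) x = initialMass C (2 * x) / 2 := by
  rw [initialMass, initialMass, ← volume_real_preimage_two_mul]
  congr 1
  ext y
  simp only [Set.mem_inter_iff, Set.mem_Ico, Set.mem_preimage]
  constructor
  · rintro ⟨⟨h₀, h₁⟩, hC⟩
    rw [doublingMap_of_lt_half h₀ (by linarith)] at hC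
    exact ⟨⟨by linarith, by linarith⟩, hC⟩
  · rintro ⟨⟨h₀, h₁⟩, hC⟩
    refine ⟨⟨by linarith, by linarith⟩, ?_⟩
    rwa [doublingMap_of_lt_half (by linarith) (by linarith)]

lemma initialMass_preimage_of_half_le {C : Set ℝ} (hC : MeasurableSet C) {x : ℝ}
    (h : 1 / 2 ≤ x) (h' : x ≤ 1) :
    initialMass (doublingMap ⁻¹' C) x = initialMass C 1 / 2 + initialMass C (2 * x - 1) / 2 := by
  simp only [initialMass]
  rw [← volume_real_preimage_two_mul, ← volume_real_preimage_two_mul_sub_one,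
    ← measureReal_union ?_ ?_ ?_ ?_]
  · congr 1
    ext y
    simp only [Set.mem_inter_iff, Set.mem_Ico, Set.mem_preimage, Set.mem_union]
    constructor
    · rintro ⟨⟨h₀, h₁⟩, hy⟩
      rcases lt_or_ge y (1 / 2) with hlt | hge
      · rw [doublingMap_of_lt_half h₀ hlt] at hy
        exact Or.inl ⟨⟨by linarith, by linarith⟩, hy⟩
      · rw [doublingMap_of_half_le hge (by linarith)] at hy
        exact Or.inr ⟨⟨by linarith, by linarith⟩, hy⟩
    · rintro (⟨⟨h₀, h₁⟩, hy⟩ | ⟨⟨h₀, h₁⟩, hy⟩)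
      · refine ⟨⟨by linarith, by linarith⟩, ?_⟩
        rwa [doublingMap_of_lt_half (by linarith) (by linarith)]
      · refine ⟨⟨by linarith, by linarith⟩, ?_⟩
        rwa [doublingMap_of_half_le (by linarith) (by linarith)]
  · rw [Set.disjoint_left]
    rintro y ⟨⟨_, h₁⟩, _⟩ ⟨⟨h₂, _⟩, _⟩
    simp only at h₁ h₂
    linarith
  · exact (measurableSet_Ico.inter hC).preimage (by fun_prop)
  · refine ((measure_mono (t := Set.Ico (0 : ℝ) (1 / 2)) ?_).trans_lt measure_Ico_lt_top).ne
    rintro y ⟨⟨h₀, h₁⟩, _⟩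
    exact ⟨by linarith, by linarith⟩
  · refine ((measure_mono (t := Set.Ico (1 / 2) x) ?_).trans_lt measure_Ico_lt_top).ne
    rintro y ⟨⟨h₀, h₁⟩, _⟩
    exact ⟨by linarith, by linarith⟩

lemma initialMass_one_preimage {C : Set ℝ} (hC : MeasurableSet C) :
    initialMass (doublingMap ⁻¹' C) 1 = initialMass C 1 := by
  rw [initialMass_preimage_of_half_le hC (by norm_num) le_rfl]
  norm_num

lemma initialMass_zero (C : Set ℝ) : initialMass C 0 = 0 := by simp [initialMass]

lemma discrepancy_zero (C : Set ℝ) : discrepancy C 0 = 0 := by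
  simp [discrepancy, initialMass_zero]

lemma discrepancy_one (C : Set ℝ) : discrepancy C 1 = 0 := by simp [discrepancy]

lemma discrepancy_preimage {C : Set ℝ} (hC : MeasurableSet C) {x : ℝ}
    (hx : x ∈ Set.Icc (0 : ℝ) 1) :
    discrepancy (doublingMap ⁻¹' C) x = discrepancy C (doublingMap x) / 2 := by
  rcases hx.2.eq_or_lt with rfl | h₁
  · have : doublingMap 1 = 0 := by
      rw [doublingMap, Int.fract_eq_iff]; exact ⟨by simp, by simp, 2, by norm_num⟩
    rw [this, discrepancy_zero, discrepancy_one, zero_div]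
  rw [discrepancy, initialMass_one_preimage hC, discrepancy]
  rcases lt_or_ge x (1 / 2) with h | h
  · rw [doublingMap_of_lt_half hx.1 h, initialMass_preimage_of_lt_half C h]
    ring
  · rw [doublingMap_of_half_le h h₁, initialMass_preimage_of_half_le hC h h₁.le]
    ring

lemma discrepancy_preimage_iterate {C : Set ℝ} (hC : MeasurableSet C) (n : ℕ) {x : ℝ}
    (hx : x ∈ Set.Icc (0 : ℝ) 1) :
    discrepancy (doublingMap^[n] ⁻¹' C) x = discrepancy C (doublingMap^[n] x) / 2 ^ n := by
  induction n generalizing x with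
  | zero => simp
  | succ n ih =>
    rw [Function.iterate_succ, Set.preimage_comp,
      discrepancy_preimage (measurable_doublingMap.iterate n hC) hx,
      ih (Set.Ico_subset_Icc_self (doublingMap_mem_Ico x)), Function.comp_apply, pow_succ]
    ring

lemma unitMeasure_real_eq_initialMass {C : Set ℝ} (hC : MeasurableSet C) :
    unitMeasure.real C = initialMass C 1 := by
  rw [unitMeasure, measureReal_restrict_apply hC, initialMass, Set.inter_comm]

lemma measurePreserving_doublingMap : MeasurePreserving doublingMap unitMeasure unitMeasure := by
  refine ⟨measurable_doublingMap, ?_⟩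
  ext C hC
  rw [Measure.map_apply measurable_doublingMap hC, ← measureReal_eq_measureReal_iff,
    unitMeasure_real_eq_initialMass hC,
    unitMeasure_real_eq_initialMass (measurable_doublingMap hC), initialMass_one_preimage hC]

lemma initialMass_one_preimage_iterate {C : Set ℝ} (hC : MeasurableSet C) (n : ℕ) :
    initialMass (doublingMap^[n] ⁻¹' C) 1 = initialMass C 1 := by
  rw [← unitMeasure_real_eq_initialMass hC,
    ← unitMeasure_real_eq_initialMass (measurable_doublingMap.iterate n hC), measureReal_def,
    (measurePreserving_doublingMap.iterate n).measure_preimage hC.nullMeasurableSet,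
    measureReal_def]

/-- The mass of `[0, x) ∩ T⁻ⁿ C`, where `T` is the doubling map. -/
lemma initialMass_preimage_iterate {C : Set ℝ} (hC : MeasurableSet C) (n : ℕ) {x : ℝ}
    (hx : x ∈ Set.Icc (0 : ℝ) 1) :
    initialMass (doublingMap^[n] ⁻¹' C) x =
      x * initialMass C 1 + discrepancy C (doublingMap^[n] x) / 2 ^ n := by
  rw [← discrepancy_preimage_iterate hC n hx, discrepancy, initialMass_one_preimage_iterate hC]
  ring

lemma initialMass_mem_Icc (C : Set ℝ) {x : ℝ} (hx : x ∈ Set.Icc (0 : ℝ) 1) :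
    initialMass C x ∈ Set.Icc (0 : ℝ) 1 := by
  refine ⟨measureReal_nonneg, (measureReal_mono Set.inter_subset_left (by simp)).trans ?_⟩
  simp [hx.1, hx.2]

lemma abs_discrepancy_le_one (C : Set ℝ) {x : ℝ} (hx : x ∈ Set.Icc (0 : ℝ) 1) :
    |discrepancy C x| ≤ 1 := by
  have h := initialMass_mem_Icc C hx
  have h' := initialMass_mem_Icc C (x := 1) (by simp)
  rw [discrepancy, abs_le]
  constructor <;> nlinarith [h.1, h.2, h'.1, h'.2, hx.1, hx.2]

lemma iterate_doublingMap_mem_Icc (n : ℕ) {x : ℝ} (hx : x ∈ Set.Icc (0 : ℝ) 1) :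
    doublingMap^[n] x ∈ Set.Icc (0 : ℝ) 1 := by
  cases n with
  | zero => exact hx
  | succ n =>
    rw [Function.iterate_succ_apply']
    exact Set.Ico_subset_Icc_self (doublingMap_mem_Ico _)

lemma tendsto_initialMass_preimage_iterate {C : Set ℝ} (hC : MeasurableSet C) {x : ℝ}
    (hx : x ∈ Set.Icc (0 : ℝ) 1) :
    Tendsto (fun n => initialMass (doublingMap^[n] ⁻¹' C) x) atTop
      (𝓝 (x * initialMass C 1)) := by
  simp only [initialMass_preimage_iterate hC _ hx]
  have h : Tendsto (fun n => discrepancy C (doublingMap^[n] x) / 2 ^ n) atTop (𝓝 0) := by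
    refine squeeze_zero_norm (a := fun n : ℕ => (1 / 2 : ℝ) ^ n) (fun n => ?_)
      (tendsto_pow_atTop_nhds_zero_of_lt_one (by norm_num) (by norm_num))
    rw [Real.norm_eq_abs, abs_div, abs_of_pos (pow_pos two_pos n : (0 : ℝ) < 2 ^ n), one_div_pow]
    gcongr
    exact abs_discrepancy_le_one C (iterate_doublingMap_mem_Icc n hx)
  simpa using h.const_add (x * initialMass C 1)

lemma hasSum_measureReal_iUnion {X : Type*} {m : MeasurableSpace X} {μ : Measure X}
    [IsFiniteMeasure μ] {f : ℕ → Set X} (hd : Pairwise (Function.onFun Disjoint f))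
    (hf : ∀ i, MeasurableSet (f i)) :
    HasSum (fun i => μ.real (f i)) (μ.real (⋃ i, f i)) := by
  have h := measure_iUnion (μ := μ) hd hf
  rw [measureReal_def, h, ENNReal.tsum_toReal_eq fun _ => measure_ne_top _ _]
  exact (ENNReal.summable_toReal (h ▸ measure_ne_top _ _)).hasSum

/-- If asymptotic independence of `A` from the sets `C n` holds for `A` in a generating π-system,
and the measure of `C n` is constant, then it holds for every measurable `A`. -/
lemma tendsto_measureReal_inter_of_isPiSystem {X : Type*} {m : MeasurableSpace X} {μ : Measure X}
    [IsProbabilityMeasure μ] {P : Set (Set X)} (hm : m = MeasurableSpace.generateFrom P)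
    (hP : IsPiSystem P) {C : ℕ → Set X} (hC : ∀ n, MeasurableSet (C n)) {c : ℝ}
    (hc : ∀ n, μ.real (C n) = c)
    (h : ∀ A ∈ P, Tendsto (fun n => μ.real (A ∩ C n)) atTop (𝓝 (μ.real A * c)))
    {A : Set X} (hA : MeasurableSet A) :
    Tendsto (fun n => μ.real (A ∩ C n)) atTop (𝓝 (μ.real A * c)) := by
  induction A, hA using MeasurableSpace.induction_on_inter hm hP with
  | empty => simp
  | basic A hA => exact h A hA
  | compl A hA ih =>
    have key : ∀ n, μ.real (Aᶜ ∩ C n) = c - μ.real (A ∩ C n) := fun n => by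
      have := measureReal_inter_add_sdiff (μ := μ) (s := C n) hA
      rw [hc] at this
      rw [Set.inter_comm, ← Set.sdiff_eq, Set.inter_comm A]
      linarith
    simp only [key]
    rw [probReal_compl_eq_one_sub hA, sub_mul, one_mul]
    exact ih.const_sub c
  | iUnion f hd hf ih =>
    have hsum : ∀ D, MeasurableSet D →
        HasSum (fun i => μ.real (f i ∩ D)) (μ.real ((⋃ i, f i) ∩ D)) := fun D hD => by
      rw [Set.iUnion_inter]
      exact hasSum_measureReal_iUnion
        (fun i j hij => (hd hij).mono Set.inter_subset_left Set.inter_subset_left)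
        (fun i => (hf i).inter hD)
    have hsum' : HasSum (fun i => μ.real (f i)) (μ.real (⋃ i, f i)) := by
      simpa using hsum Set.univ MeasurableSet.univ
    simp only [← fun n => (hsum (C n) (hC n)).tsum_eq]
    rw [← (hsum'.mul_right c).tsum_eq]
    refine tendsto_tsum_of_dominated_convergence hsum'.summable ih (Eventually.of_forall ?_)
    intro n i
    rw [Real.norm_of_nonneg measureReal_nonneg]
    exact measureReal_mono Set.inter_subset_left

lemma unitMeasure_real_Iio_inter {C : Set ℝ} (hC : MeasurableSet C) (x : ℝ) :
    unitMeasure.real (Set.Iio x ∩ C) = initialMass C (max 0 (min x 1)) := by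
  rw [unitMeasure_real_eq_initialMass (measurableSet_Iio.inter hC), initialMass, initialMass]
  congr 1
  ext y
  simp only [Set.mem_inter_iff, Set.mem_Ico, Set.mem_Iio, lt_max_iff, lt_min_iff]
  constructor
  · rintro ⟨⟨h₀, h₁⟩, h₂, h₃⟩
    exact ⟨⟨h₀, Or.inr ⟨h₂, h₁⟩⟩, h₃⟩
  · rintro ⟨⟨h₀, h₁ | ⟨h₁, h₂⟩⟩, h₃⟩
    · linarith
    · exact ⟨⟨h₀, h₂⟩, h₁, h₃⟩

lemma initialMass_univ {x : ℝ} (hx : 0 ≤ x) : initialMass Set.univ x = x := by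
  simp [initialMass, hx]

lemma tendsto_unitMeasure_inter_preimage {A B : Set ℝ} (hA : MeasurableSet A)
    (hB : MeasurableSet B) :
    Tendsto (fun n : ℕ => unitMeasure (A ∩ doublingMap^[n] ⁻¹' B)) atTop
      (𝓝 (unitMeasure A * unitMeasure B)) := by
  have hT n : MeasurableSet (doublingMap^[n] ⁻¹' B) := measurable_doublingMap.iterate n hB
  have h := tendsto_measureReal_inter_of_isPiSystem (μ := unitMeasure)
    (borel_eq_generateFrom_Iio ℝ ▸ BorelSpace.measurable_eq) isPiSystem_Iio hT
    (c := unitMeasure.real B)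
    (fun n => by rw [unitMeasure_real_eq_initialMass (hT n),
      initialMass_one_preimage_iterate hB, unitMeasure_real_eq_initialMass hB]) ?_ hA
  · rw [← ENNReal.tendsto_toReal_iff (fun _ => measure_ne_top _ _)
      (ENNReal.mul_ne_top (measure_ne_top _ _) (measure_ne_top _ _)), ENNReal.toReal_mul]
    exact h
  · rintro _ ⟨x, rfl⟩
    have hx : max 0 (min x 1) ∈ Set.Icc (0 : ℝ) 1 := ⟨by simp, by simp⟩
    have hx' := unitMeasure_real_Iio_inter MeasurableSet.univ x
    rw [Set.inter_univ, initialMass_univ hx.1] at hx'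
    rw [hx', unitMeasure_real_eq_initialMass hB]
    simp only [unitMeasure_real_Iio_inter (hT _)]
    exact tendsto_initialMass_preimage_iterate hB hx

lemma initialMass_Ico {a b x : ℝ} (ha : 0 ≤ a) :
    initialMass (Set.Ico a b) x = max (min x b - a) 0 := by
  rw [initialMass, Set.Ico_inter_Ico, Real.volume_real_Ico, max_eq_right ha]

lemma unitMeasure_real_Ico_inter_preimage {a b : ℝ} (ha : 0 ≤ a) (hab : a ≤ b) (hb : b ≤ 1)
    {C : Set ℝ} (hC : MeasurableSet C) (n : ℕ) :
    unitMeasure.real (Set.Ico a b ∩ doublingMap^[n] ⁻¹' C) =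
      (b - a) * initialMass C 1 +
        (discrepancy C (doublingMap^[n] b) - discrepancy C (doublingMap^[n] a)) / 2 ^ n := by
  have hD : MeasurableSet (doublingMap^[n] ⁻¹' C) := measurable_doublingMap.iterate n hC
  have hsplit : initialMass (doublingMap^[n] ⁻¹' C) b = initialMass (doublingMap^[n] ⁻¹' C) a +
      unitMeasure.real (Set.Ico a b ∩ doublingMap^[n] ⁻¹' C) := by
    rw [unitMeasure, measureReal_restrict_apply (measurableSet_Ico.inter hD),
      Set.inter_eq_left.2 (Set.inter_subset_left.trans (Set.Ico_subset_Ico ha hb)), initialMass,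
      initialMass, ← Set.Ico_union_Ico_eq_Ico ha hab, Set.union_inter_distrib_right,
      measureReal_union _ (measurableSet_Ico.inter hD)
        (measure_ne_top_of_subset Set.inter_subset_left (by simp))
        (measure_ne_top_of_subset Set.inter_subset_left (by simp))]
    exact (Set.Ico_disjoint_Ico_same).mono Set.inter_subset_left Set.inter_subset_left
  rw [initialMass_preimage_iterate hC n ⟨ha, hab.trans hb⟩,
    initialMass_preimage_iterate hC n ⟨ha.trans hab, hb⟩] at hsplit
  rw [sub_div]
  linarith

lemma unitMeasure_real_Ico {a b : ℝ} (ha : 0 ≤ a) (hab : a ≤ b) (hb : b ≤ 1) :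
    unitMeasure.real (Set.Ico a b) = b - a := by
  rw [unitMeasure_real_eq_initialMass measurableSet_Ico, initialMass_Ico ha, min_eq_right hb,
    max_eq_left (by linarith)]

lemma unitMeasure_Ico {a b : ℝ} (ha : 0 ≤ a) (hab : a ≤ b) (hb : b ≤ 1) :
    unitMeasure (Set.Ico a b) = ENNReal.ofReal (b - a) := by
  rw [← unitMeasure_real_Ico ha hab hb, ofReal_measureReal]

lemma iterate_doublingMap_one_third (n : ℕ) :
    doublingMap^[n] (1 / 3) = 1 / 3 ∨ doublingMap^[n] (1 / 3) = 2 / 3 := by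
  induction n with
  | zero => exact Or.inl rfl
  | succ n ih =>
    rw [Function.iterate_succ_apply']
    rcases ih with h | h <;> rw [h]
    · right; rw [doublingMap_of_lt_half] <;> norm_num
    · left; rw [doublingMap_of_half_le] <;> norm_num

lemma iterate_doublingMap_five_sixths {n : ℕ} (hn : 1 ≤ n) :
    doublingMap^[n] (5 / 6) = 1 / 3 ∨ doublingMap^[n] (5 / 6) = 2 / 3 := by
  have h : doublingMap (5 / 6) = doublingMap (1 / 3) := by
    rw [doublingMap_of_half_le, doublingMap_of_lt_half] <;> norm_num
  obtain ⟨k, rfl⟩ := Nat.exists_eq_add_of_le' hn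
  rw [Function.iterate_succ_apply, h, ← Function.iterate_succ_apply]
  exact iterate_doublingMap_one_third _

lemma doublingMap_zero : doublingMap 0 = 0 := by simp [doublingMap]

lemma iterate_doublingMap_half {n : ℕ} (hn : 1 ≤ n) : doublingMap^[n] (1 / 2) = 0 := by
  obtain ⟨k, rfl⟩ := Nat.exists_eq_add_of_le' hn
  rw [Function.iterate_succ_apply, doublingMap_of_half_le le_rfl (by norm_num)]
  norm_num [Function.iterate_fixed doublingMap_zero]

theorem stmt_0 :
    ∃ (X : Type) (_ : MeasurableSpace X) (μ : Measure X) (T : X → X),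
      IsProbabilityMeasure μ ∧ Measurable T ∧ MeasurePreserving T μ μ ∧
      -- mixing
      (∀ A B : Set X, MeasurableSet A → MeasurableSet B →
        Tendsto (fun n : ℕ => μ (A ∩ T^[n] ⁻¹' B)) atTop (𝓝 (μ A * μ B))) ∧
      -- strictly under-recurrent set A
      (∃ A : Set X, MeasurableSet A ∧ 0 < μ A ∧ μ A < 1 ∧
        ∀ n : ℕ, 1 ≤ n → μ (A ∩ T^[n] ⁻¹' A) < μ A ^ 2) ∧
      -- strictly over-recurrent set B
      (∃ B : Set X, MeasurableSet B ∧ 0 < μ B ∧ μ B < 1 ∧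
        ∀ n : ℕ, 1 ≤ n → μ (B ∩ T^[n] ⁻¹' B) > μ B ^ 2) := by
  refine ⟨ℝ, inferInstance, unitMeasure, doublingMap, inferInstance, measurable_doublingMap,
    measurePreserving_doublingMap, fun A B => tendsto_unitMeasure_inter_preimage,
    ⟨Set.Ico (1 / 2) (5 / 6), measurableSet_Ico, ?_, ?_, fun n hn => ?_⟩,
    ⟨Set.Ico 0 (1 / 3), measurableSet_Ico, ?_, ?_, fun n hn => ?_⟩⟩
  · rw [unitMeasure_Ico (by norm_num) (by norm_num) (by norm_num), ENNReal.ofReal_pos]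
    norm_num
  · rw [unitMeasure_Ico (by norm_num) (by norm_num) (by norm_num), ENNReal.ofReal_lt_one]
    norm_num
  · rw [← ENNReal.toReal_lt_toReal (measure_ne_top _ _) (ENNReal.pow_ne_top (measure_ne_top _ _)),
      ENNReal.toReal_pow, ← measureReal_def, ← measureReal_def,
      unitMeasure_real_Ico (by norm_num) (by norm_num) (by norm_num),
      unitMeasure_real_Ico_inter_preimage (by norm_num) (by norm_num) (by norm_num)
        measurableSet_Ico, iterate_doublingMap_half hn, discrepancy_zero, sub_zero,
      initialMass_Ico (by norm_num)]
    have h : discrepancy (Set.Ico (1 / 2) (5 / 6)) (doublingMap^[n] (5 / 6)) < 0 := by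
      rcases iterate_doublingMap_five_sixths hn with h | h <;>
        rw [h, discrepancy, initialMass_Ico (by norm_num), initialMass_Ico (by norm_num)] <;>
        norm_num
    have := div_neg_of_neg_of_pos h (pow_pos two_pos n)
    norm_num at this ⊢
    linarith
  · rw [unitMeasure_Ico (by norm_num) (by norm_num) (by norm_num), ENNReal.ofReal_pos]
    norm_num
  · rw [unitMeasure_Ico (by norm_num) (by norm_num) (by norm_num), ENNReal.ofReal_lt_one]
    norm_num
  · rw [gt_iff_lt,
      ← ENNReal.toReal_lt_toReal (ENNReal.pow_ne_top (measure_ne_top _ _)) (measure_ne_top _ _),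
      ENNReal.toReal_pow, ← measureReal_def, ← measureReal_def,
      unitMeasure_real_Ico (by norm_num) (by norm_num) (by norm_num),
      unitMeasure_real_Ico_inter_preimage (by norm_num) (by norm_num) (by norm_num)
        measurableSet_Ico, Function.iterate_fixed doublingMap_zero, discrepancy_zero, sub_zero,
      initialMass_Ico le_rfl]
    have h : 0 < discrepancy (Set.Ico 0 (1 / 3)) (doublingMap^[n] (1 / 3)) := by
      rcases iterate_doublingMap_one_third n with h | h <;>
        rw [h, discrepancy, initialMass_Ico le_rfl, initialMass_Ico le_rfl] <;>
        norm_num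
    have := div_pos h (pow_pos two_pos n : (0 : ℝ) < 2 ^ n)
    norm_num at this ⊢
    linarith
end

section
/- For every set S ⊆ ℕ (viewed as a partition ℕ = S ∪ (ℕ \ S)) there exist a measure preserving system (X, 𝒳, μ, T) that is mixing and a set A ∈ 𝒳 with 0 < μ(A) < 1 such that μ(A ∩ T⁻ⁿA) > μ(A)² for every n ∈ S and μ(A ∩ T⁻ⁿA) < μ(A)² for every n ∈ ℕ \ S. -/
open MeasureTheory Filter Topology
open ProbabilityTheory

/-- If measures dominated by a finite measure converge on the whole space and on a generating
π-system, they converge on every measurable set. -/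
theorem tendsto_measure_of_isPiSystem {X : Type*} [mX : MeasurableSpace X]
    {m : ℕ → Measure X} {m' μ : Measure X} [IsFiniteMeasure μ] [IsFiniteMeasure m']
    (hle : ∀ n, m n ≤ μ) {C : Set (Set X)} (hgen : mX = MeasurableSpace.generateFrom C)
    (hC : IsPiSystem C) (huniv : Tendsto (fun n => m n Set.univ) atTop (𝓝 (m' Set.univ)))
    (hbasic : ∀ s ∈ C, Tendsto (fun n => m n s) atTop (𝓝 (m' s))) {s : Set X}
    (hs : MeasurableSet s) : Tendsto (fun n => m n s) atTop (𝓝 (m' s)) := by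
  have hfin : ∀ n, IsFiniteMeasure (m n) := fun n => isFiniteMeasure_of_le μ (hle n)
  induction s, hs using MeasurableSpace.induction_on_inter hgen hC with
  | empty => simp
  | basic t ht => exact hbasic t ht
  | compl t ht ih =>
    simp only [fun n => measure_compl (μ := m n) ht (measure_ne_top _ _),
      measure_compl (μ := m') ht (measure_ne_top _ _)]
    exact ENNReal.Tendsto.sub huniv ih (.inl (measure_ne_top _ _))
  | iUnion f hd hf ih =>
    simp only [fun n => measure_iUnion (μ := m n) hd hf, measure_iUnion (μ := m') hd hf,
      ← lintegral_count]
    refine tendsto_lintegral_of_dominated_convergence (fun i => μ (f i))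
      (fun n => measurable_of_countable _) (fun n => .of_forall fun i => hle n _) ?_
      (.of_forall ih)
    rw [lintegral_count, ← measure_iUnion hd hf]
    exact measure_ne_top _ _

/-- To check mixing it suffices to consider pairs of sets from a generating π-system. -/
theorem mixing_of_isPiSystem {X : Type*} [mX : MeasurableSpace X] {μ : Measure X}
    [IsProbabilityMeasure μ] {T : X → X} (hT : MeasurePreserving T μ μ)
    {C : Set (Set X)} (hgen : mX = MeasurableSpace.generateFrom C) (hC : IsPiSystem C)
    (hmix : ∀ A ∈ C, ∀ B ∈ C,
      Tendsto (fun n : ℕ => μ (A ∩ T^[n] ⁻¹' B)) atTop (𝓝 (μ A * μ B)))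
    {A B : Set X} (hA : MeasurableSet A) (hB : MeasurableSet B) :
    Tendsto (fun n : ℕ => μ (A ∩ T^[n] ⁻¹' B)) atTop (𝓝 (μ A * μ B)) := by
  have hmeas : ∀ s ∈ C, MeasurableSet s := fun s hs => by
    rw [hgen]; exact .basic s hs
  have left : ∀ B ∈ C, ∀ A, MeasurableSet A →
      Tendsto (fun n : ℕ => μ (A ∩ T^[n] ⁻¹' B)) atTop (𝓝 (μ A * μ B)) := by
    intro B hB A hA
    have key : ∀ {A}, MeasurableSet A → ∀ n,
        μ (A ∩ T^[n] ⁻¹' B) = μ.restrict (T^[n] ⁻¹' B) A :=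
      fun hA n => (Measure.restrict_apply hA).symm
    have key' : ∀ A, μ A * μ B = (μ B • μ) A := fun A => by simp [mul_comm]
    have : IsFiniteMeasure (μ B • μ) := μ.smul_finite (measure_ne_top _ _)
    simp only [key hA, key']
    refine tendsto_measure_of_isPiSystem (fun n => Measure.restrict_le_self (μ := μ)) hgen hC ?_
      (fun s hs => ?_) hA
    · simp [(hT.iterate _).measure_preimage (hmeas B hB).nullMeasurableSet]
    · simpa only [key (hmeas s hs), key'] using hmix s hs B hB
  have key : ∀ {B}, MeasurableSet B → ∀ n,
      μ (A ∩ T^[n] ⁻¹' B) = (μ.restrict A).map T^[n] B := fun hB n => by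
    rw [Measure.map_apply (hT.iterate n).measurable hB,
      Measure.restrict_apply ((hT.iterate n).measurable hB), Set.inter_comm]
  have key' : ∀ B, μ A * μ B = (μ A • μ) B := fun B => by simp
  have : IsFiniteMeasure (μ A • μ) := μ.smul_finite (measure_ne_top _ _)
  simp only [key hB, key']
  refine tendsto_measure_of_isPiSystem (μ := μ) (fun n => ?_) hgen hC ?_ (fun s hs => ?_) hB
  · exact (Measure.map_mono Measure.restrict_le_self (hT.iterate n).measurable).trans_eq
      (hT.iterate n).map_eq
  · simp [← key .univ]
  · simpa only [key (hmeas s hs), key'] using left s hs A hA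

theorem measurePreserving_precomp_infinitePi {ι Y : Type*} [MeasurableSpace Y] (ν : Measure Y)
    [IsProbabilityMeasure ν] {τ : ι → ι} (hτ : τ.Injective) :
    MeasurePreserving (fun x : ι → Y => x ∘ τ) (Measure.infinitePi fun _ : ι => ν)
      (Measure.infinitePi fun _ : ι => ν) := by
  refine ⟨by fun_prop, ?_⟩
  exact Measure.map_infinitePi_infinitePi_of_inj (P := fun _ : ι => ν) hτ

theorem iterate_precomp_apply {ι Y : Type*} (τ : ι → ι) (n : ℕ) (x : ι → Y) :
    (fun x : ι → Y => x ∘ τ)^[n] x = x ∘ τ^[n] := by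
  induction n generalizing x with
  | zero => rfl
  | succ n ih => rw [Function.iterate_succ_apply, ih, Function.iterate_succ']; rfl

/-- Reindexing an i.i.d. family along an injection which moves every finite set of indices away
from itself is mixing. -/
theorem mixing_precomp_infinitePi {ι Y : Type*} [MeasurableSpace Y] (ν : Measure Y)
    [IsProbabilityMeasure ν] {τ : ι → ι} (hτ : τ.Injective)
    (hdisj : ∀ s t : Finset ι, ∀ᶠ n : ℕ in atTop, ∀ i ∈ t, τ^[n] i ∉ s)
    {A B : Set (ι → Y)} (hA : MeasurableSet A) (hB : MeasurableSet B) :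
    Tendsto (fun n : ℕ => Measure.infinitePi (fun _ : ι => ν)
        (A ∩ (fun x : ι → Y => x ∘ τ)^[n] ⁻¹' B)) atTop
      (𝓝 (Measure.infinitePi (fun _ : ι => ν) A * Measure.infinitePi (fun _ : ι => ν) B)) := by
  classical
  have hT := measurePreserving_precomp_infinitePi ν hτ
  refine mixing_of_isPiSystem hT generateFrom_squareCylinders.symm
    (isPiSystem_squareCylinders (fun _ => MeasurableSpace.isPiSystem_measurableSet) (by simp))
    ?_ hA hB
  rintro _ ⟨s, a, ha, rfl⟩ _ ⟨t, b, hb, rfl⟩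
  simp only [Set.mem_univ_pi, Set.mem_ofPred_eq] at ha hb
  refine tendsto_const_nhds.congr' ?_
  filter_upwards [hdisj s t] with n hn
  have hpre : (fun x : ι → Y => x ∘ τ)^[n] ⁻¹' Set.pi t b =
      {x | ∀ i ∈ t, x (τ^[n] i) ∈ b i} := by
    ext x; simp [iterate_precomp_apply, Set.mem_pi]
  rw [← (hT.iterate n).measure_preimage
    (MeasurableSet.pi t.countable_toSet fun i _ => hb i).nullMeasurableSet]
  have hind := (iIndepFun_infinitePi (P := fun _ : ι => ν) (X := fun _ y => y)
    (fun _ => measurable_id)).indepFun_finset s (t.image τ^[n])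
    (Finset.disjoint_left.2 fun i hi hi' => by
      obtain ⟨j, hj, rfl⟩ := Finset.mem_image.1 hi'
      exact hn j hj hi) (by fun_prop)
  have h := hind.measure_inter_preimage_eq_mul {x | ∀ i : s, x i ∈ a i}
    {x | ∀ i : t, x ⟨τ^[n] i, Finset.mem_image_of_mem _ i.2⟩ ∈ b i} ?_ ?_
  · rw [hpre]
    convert h.symm using 2 <;> simp [Set.pi, Set.preimage]
  · rw [Set.ofPred_forall]
    exact MeasurableSet.iInter fun i => measurable_pi_apply i (ha i)
  · rw [Set.ofPred_forall]
    exact MeasurableSet.iInter fun i =>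
      measurable_pi_apply (⟨τ^[n] i, Finset.mem_image_of_mem _ i.2⟩ : ↥(t.image τ^[n])) (hb i)

/-- The sign `1` on `R` and `-1` off `R`. -/
noncomputable def signOf (R : Set ℕ) (m : ℕ) : ℝ :=
  open Classical in if m ∈ R then 1 else -1

theorem signOf_of_mem {R : Set ℕ} {m : ℕ} (h : m ∈ R) : signOf R m = 1 := by simp [signOf, h]

theorem signOf_of_notMem {R : Set ℕ} {m : ℕ} (h : m ∉ R) : signOf R m = -1 := by
  simp [signOf, h]

theorem abs_signOf (R : Set ℕ) (m : ℕ) : |signOf R m| = 1 := by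
  by_cases h : m ∈ R <;> simp [signOf, h]

/-- The geometric distribution giving mass `(1 / 2) ^ (k + 1)` to `k`. -/
noncomputable abbrev halfGeometric : Measure ℕ := geometricMeasure ⟨1 / 2, by norm_num, by norm_num⟩

theorem halfGeometric_real_singleton (k : ℕ) :
    halfGeometric.real {k} = (1 / 2) ^ (k + 1) := by
  rw [geometricMeasure_real_singleton (by rw [ne_eq, Subtype.ext_iff]; norm_num)]
  norm_num [pow_succ]

theorem halfGeometric_real_inter (R : Set ℕ) (j k : ℕ) :
    halfGeometric.real ({y | y = 0 ↔ j ∈ R} ∩ {y | y = 0 ↔ k ∈ R}) =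
      (1 + signOf R j * signOf R k) / 4 := by
  have h0 : halfGeometric.real {y | y = 0} = 1 / 2 := by
    simpa using halfGeometric_real_singleton 0
  have h1 : halfGeometric.real {y | ¬ y = 0} = 1 / 2 := by
    change halfGeometric.real {y | y = 0}ᶜ = 1 / 2
    rw [probReal_compl_eq_one_sub (.of_discrete), h0]; norm_num
  by_cases hj : j ∈ R <;> by_cases hk : k ∈ R <;>
    simp only [signOf, hj, hk, iff_true, iff_false, if_true, if_false, Set.inter_self, h0, h1] <;>
    norm_num [← Set.ofPred_and]

theorem halfGeometric_real_iff (R : Set ℕ) (j : ℕ) :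
    halfGeometric.real {y | y = 0 ↔ j ∈ R} = 1 / 2 := by
  rw [← Set.inter_self {y | y = 0 ↔ j ∈ R}, halfGeometric_real_inter]
  by_cases hj : j ∈ R <;> simp [signOf, hj] <;> norm_num

/-- The law of i.i.d. geometric variables indexed by two copies of `ℕ`. -/
noncomputable abbrev iidMeasure : Measure (ℕ ⊕ ℕ → ℕ) := Measure.infinitePi fun _ => halfGeometric

theorem iidMeasure_real_pi (s : Finset (ℕ ⊕ ℕ)) (t : ℕ ⊕ ℕ → Set ℕ) :
    iidMeasure.real (Set.pi s t) = ∏ i ∈ s, halfGeometric.real (t i) := by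
  rw [measureReal_def, Measure.infinitePi_pi _ fun _ _ => .of_discrete, ENNReal.toReal_prod]
  rfl

/-- The variable `x (inr 0)` selects which `x (inl j)` is compared with `R`. -/
def selectedSet (R : Set ℕ) : Set (ℕ ⊕ ℕ → ℕ) :=
  {x | x (.inl (x (.inr 0))) = 0 ↔ x (.inr 0) ∈ R}

theorem hasSum_measureReal_fiber {X Y : Type*} [MeasurableSpace X] [MeasurableSpace Y]
    [Countable Y] [MeasurableSingletonClass Y] {μ : Measure X} [IsFiniteMeasure μ] {f : X → Y}
    (hf : Measurable f) {A : Set X} (hA : MeasurableSet A) :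
    HasSum (fun y => μ.real (A ∩ f ⁻¹' {y})) (μ.real A) := by
  have h : ∑' y, μ (A ∩ f ⁻¹' {y}) = μ A := by
    rw [← measure_iUnion _ fun y => hA.inter (hf (measurableSet_singleton y))]
    · congr 1; ext x; simp
    · intro y z hyz
      exact Disjoint.mono Set.inter_subset_right Set.inter_subset_right
        (Disjoint.preimage f (by simpa using hyz))
  have hne : ∑' y, μ (A ∩ f ⁻¹' {y}) ≠ ⊤ := h ▸ measure_ne_top _ _
  have := ENNReal.hasSum_toReal hne
  rwa [← ENNReal.tsum_toReal_eq (ENNReal.ne_top_of_tsum_ne_top hne), h] at this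

theorem measurableSet_selectedSet (R : Set ℕ) : MeasurableSet (selectedSet R) := by
  have : selectedSet R = ⋃ j : ℕ, {x | x (.inr 0) = j} ∩ {x | x (.inl j) = 0 ↔ j ∈ R} := by
    ext x; simp [selectedSet]
  rw [this]
  exact MeasurableSet.iUnion fun j =>
    MeasurableSet.inter
      (measurable_pi_apply (X := fun _ => ℕ) (Sum.inr 0) (measurableSet_singleton j))
      (measurable_pi_apply (X := fun _ => ℕ) (Sum.inl j) (.of_discrete (s := {y | y = 0 ↔ j ∈ R})))

theorem hasSum_half_pow_succ : HasSum (fun k : ℕ => ((1 : ℝ) / 2) ^ (k + 1)) 1 := by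
  simpa [pow_succ, div_eq_mul_inv] using hasSum_geometric_two.mul_right (1 / 2 : ℝ)

theorem iidMeasure_real_selectedSet (R : Set ℕ) : iidMeasure.real (selectedSet R) = 1 / 2 := by
  refine (hasSum_measureReal_fiber (f := fun x : ℕ ⊕ ℕ → ℕ => x (.inr 0)) (by fun_prop)
    (measurableSet_selectedSet R)).unique ?_
  rw [← one_mul (1 / 2 : ℝ)]
  convert! hasSum_half_pow_succ.mul_right (1 / 2 : ℝ) using 2 with j
  · have : selectedSet R ∩ (fun x : ℕ ⊕ ℕ → ℕ => x (.inr 0)) ⁻¹' {j} =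
        Set.pi ({.inr 0, .inl j} : Finset (ℕ ⊕ ℕ))
          (Sum.elim (fun _ => {y | y = 0 ↔ j ∈ R}) fun _ => {j}) := by
      ext x
      simp only [selectedSet, Set.mem_inter_iff, Set.mem_ofPred_eq, Set.mem_preimage,
        Set.mem_singleton_iff, Finset.coe_insert, Finset.coe_singleton, Set.insert_pi,
        Set.singleton_pi, Sum.elim_inr, Sum.elim_inl, Function.eval]
      grind
    rw [this, iidMeasure_real_pi, Finset.prod_pair (by simp)]
    simp only [Sum.elim_inr, Sum.elim_inl, halfGeometric_real_iff, halfGeometric_real_singleton]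

/-- Both index sets are translated by one. -/
def shiftIndex : ℕ ⊕ ℕ → ℕ ⊕ ℕ := Sum.map Nat.succ Nat.succ

theorem shiftIndex_injective : shiftIndex.Injective :=
  Sum.map_injective.2 ⟨Nat.succ_injective, Nat.succ_injective⟩

theorem shiftIndex_iterate (n : ℕ) : shiftIndex^[n] = Sum.map (n + ·) (n + ·) := by
  induction n with
  | zero => ext i; cases i <;> simp
  | succ n ih =>
    ext1 i; rw [Function.iterate_succ_apply, ih]; cases i <;> simp [shiftIndex] <;> omega

theorem eventually_shiftIndex_iterate_notMem (s t : Finset (ℕ ⊕ ℕ)) :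
    ∀ᶠ n : ℕ in atTop, ∀ i ∈ t, shiftIndex^[n] i ∉ s := by
  filter_upwards [eventually_gt_atTop (s.sup (Sum.elim id id))] with n hn i _ hs
  have := Finset.le_sup (f := Sum.elim id id) hs
  rw [shiftIndex_iterate] at this
  cases i <;> simp at this <;> omega

/-- The shift of both index sets, acting on sequences. -/
def doubleShift (x : ℕ ⊕ ℕ → ℕ) : ℕ ⊕ ℕ → ℕ := x ∘ shiftIndex

theorem mem_preimage_doubleShift_iterate (R : Set ℕ) (n : ℕ) (x : ℕ ⊕ ℕ → ℕ) :
    x ∈ doubleShift^[n] ⁻¹' selectedSet R ↔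
      (x (.inl (n + x (.inr n))) = 0 ↔ x (.inr n) ∈ R) := by
  have : doubleShift^[n] x = x ∘ shiftIndex^[n] := iterate_precomp_apply _ _ _
  simp [this, selectedSet, shiftIndex_iterate]

theorem iidMeasure_real_fiber (R : Set ℕ) {n : ℕ} (hn : n ≠ 0) (j k : ℕ) :
    iidMeasure.real ((selectedSet R ∩ doubleShift^[n] ⁻¹' selectedSet R) ∩
      (fun x => (x (.inr 0), x (.inr n))) ⁻¹' {(j, k)}) =
    (1 / 2) ^ (j + 1) * (1 / 2) ^ (k + 1) * (1 / 4) +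
      if j = n + k then (1 / 2) ^ (j + 1) * (1 / 2) ^ (k + 1) *
        (signOf R j * signOf R k / 4) else 0 := by
  split_ifs with h
  · have : (selectedSet R ∩ doubleShift^[n] ⁻¹' selectedSet R) ∩
      (fun x => (x (.inr 0), x (.inr n))) ⁻¹' {(j, k)} =
        Set.pi ({.inr 0, .inr n, .inl j} : Finset (ℕ ⊕ ℕ))
          (Sum.elim (fun _ => {y | y = 0 ↔ j ∈ R} ∩ {y | y = 0 ↔ k ∈ R})
            fun i => if i = 0 then {j} else {k}) := by
      ext x
      rw [Set.mem_inter_iff, Set.mem_inter_iff, mem_preimage_doubleShift_iterate]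
      simp [selectedSet, hn]
      grind
    rw [this, iidMeasure_real_pi, Finset.prod_insert (by simp [hn.symm]),
      Finset.prod_pair (by simp)]
    simp only [Sum.elim_inr, Sum.elim_inl, halfGeometric_real_inter, if_true, if_neg hn,
      halfGeometric_real_singleton]
    ring
  · have : (selectedSet R ∩ doubleShift^[n] ⁻¹' selectedSet R) ∩
      (fun x => (x (.inr 0), x (.inr n))) ⁻¹' {(j, k)} =
        Set.pi ({.inr 0, .inr n, .inl j, .inl (n + k)} : Finset (ℕ ⊕ ℕ))
          (Sum.elim (fun i => if i = j then {y | y = 0 ↔ j ∈ R} else {y | y = 0 ↔ k ∈ R})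
            fun i => if i = 0 then {j} else {k}) := by
      ext x
      rw [Set.mem_inter_iff, Set.mem_inter_iff, mem_preimage_doubleShift_iterate]
      simp [selectedSet, hn, Ne.symm h]
      grind
    rw [this, iidMeasure_real_pi, Finset.prod_insert (by simp [hn.symm]),
      Finset.prod_insert (by simp), Finset.prod_pair (by simpa using h)]
    simp only [Sum.elim_inr, Sum.elim_inl, halfGeometric_real_iff, if_true, if_neg hn,
      halfGeometric_real_singleton, if_neg (Ne.symm h)]
    ring

theorem hasSum_correlation (R : Set ℕ) {n : ℕ} (hn : n ≠ 0) :
    HasSum (fun k : ℕ => (1 / 2 : ℝ) ^ (n + 4) *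
        ((1 / 4) ^ k * (signOf R (n + k) * signOf R k)))
      (iidMeasure.real (selectedSet R ∩ doubleShift^[n] ⁻¹' selectedSet R) - 1 / 4) := by
  have hmeas : Measurable doubleShift := by unfold doubleShift; fun_prop
  have h := hasSum_measureReal_fiber (μ := iidMeasure)
    (f := fun x : ℕ ⊕ ℕ → ℕ => (x (.inr 0), x (.inr n))) (by fun_prop)
    ((measurableSet_selectedSet R).inter (hmeas.iterate n (measurableSet_selectedSet R)))
  have h' := ((hasSum_half_pow_succ.mul hasSum_half_pow_succ
    (hasSum_half_pow_succ.summable.mul_of_nonneg hasSum_half_pow_succ.summable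
      (fun _ => by positivity) fun _ => by positivity)).mul_right (1 / 4))
  have hd := h.sub h'
  have hinj : Function.Injective fun k : ℕ => (n + k, k) := fun k l hkl => (Prod.ext_iff.1 hkl).2
  rw [← hinj.hasSum_iff] at hd
  · convert! hd using 2 with k
    · simp only [Function.comp, iidMeasure_real_fiber R hn, if_true]
      rw [show (1 / 4 : ℝ) = (1 / 2) * (1 / 2) by norm_num, mul_pow]
      ring
    · norm_num
  · rintro ⟨j, k⟩ hjk
    have : j ≠ n + k := fun h => hjk ⟨k, by simp [h]⟩
    simp [iidMeasure_real_fiber R hn, this]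

/-- The first term dominates the sum defining the correlation. -/
theorem correlation_mul_signOf_pos {R : Set ℕ} (hR : 0 ∈ R) {n : ℕ} (hn : n ≠ 0) :
    0 < (iidMeasure.real (selectedSet R ∩ doubleShift^[n] ⁻¹' selectedSet R) - 1 / 4) *
      signOf R n := by
  have h := (hasSum_correlation R hn).mul_right (signOf R n)
  have hquarter : HasSum (fun k : ℕ => (1 / 4 : ℝ) ^ k) (4 / 3) := by
    convert hasSum_geometric_of_lt_one (r := (1 / 4 : ℝ)) (by norm_num) (by norm_num) using 1
    norm_num
  have hgeom := ((hasSum_ite_eq (0 : ℕ) (2 : ℝ)).sub hquarter).mul_left ((1 / 2 : ℝ) ^ (n + 4))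
  refine lt_of_lt_of_le (mul_pos (by positivity) (by norm_num)) (hasSum_le (fun k => ?_) hgeom h)
  rw [mul_assoc]
  gcongr
  have habs : |signOf R (n + k) * signOf R k * signOf R n| = 1 := by simp [abs_mul, abs_signOf]
  split_ifs with hk
  · subst hk
    have := abs_mul_abs_self (signOf R n)
    rw [abs_signOf] at this
    simp only [add_zero, pow_zero, signOf_of_mem hR]
    linarith
  · rw [mul_assoc]
    have := neg_le_of_abs_le habs.le
    have hp : (0 : ℝ) < (1 / 4) ^ k := by positivity
    nlinarith

theorem stmt_1 (S : Set ℕ) :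
    ∃ (X : Type) (_ : MeasurableSpace X) (μ : Measure X) (T : X → X),
      IsProbabilityMeasure μ ∧ Measurable T ∧ MeasurePreserving T μ μ ∧
      -- mixing
      (∀ A B : Set X, MeasurableSet A → MeasurableSet B →
        Tendsto (fun n : ℕ => μ (A ∩ T^[n] ⁻¹' B)) atTop (𝓝 (μ A * μ B))) ∧
      (∃ A : Set X, MeasurableSet A ∧ 0 < μ A ∧ μ A < 1 ∧
        ∀ n : ℕ, 1 ≤ n →
          (n ∈ S → μ (A ∩ T^[n] ⁻¹' A) > μ A ^ 2) ∧
          (n ∉ S → μ (A ∩ T^[n] ⁻¹' A) < μ A ^ 2)) := by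
  have hT : MeasurePreserving doubleShift iidMeasure iidMeasure :=
    measurePreserving_precomp_infinitePi _ shiftIndex_injective
  refine ⟨ℕ ⊕ ℕ → ℕ, inferInstance, iidMeasure, doubleShift, inferInstance, hT.measurable, hT,
    fun A B hA hB => mixing_precomp_infinitePi _ shiftIndex_injective
      eventually_shiftIndex_iterate_notMem hA hB,
    selectedSet (insert 0 S), measurableSet_selectedSet _, ?_⟩
  set A := selectedSet (insert 0 S)
  have hA : iidMeasure A = ENNReal.ofReal (1 / 2) := by
    rw [← iidMeasure_real_selectedSet (insert 0 S), ofReal_measureReal]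
  have hsq : iidMeasure A ^ 2 = ENNReal.ofReal (1 / 4) := by
    rw [hA, ← ENNReal.ofReal_pow (by norm_num)]; norm_num
  refine ⟨by rw [hA]; simp, by rw [hA, ENNReal.ofReal_lt_one]; norm_num, fun n hn => ?_⟩
  have hn0 : n ≠ 0 := by omega
  have hpos := correlation_mul_signOf_pos (Set.mem_insert 0 S) hn0
  rw [hsq, ← ofReal_measureReal (s := A ∩ doubleShift^[n] ⁻¹' A)]
  refine ⟨fun hS => ?_, fun hS => ?_⟩
  · rw [signOf_of_mem (Set.mem_insert_of_mem 0 hS)] at hpos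
    exact (ENNReal.ofReal_lt_ofReal_iff_of_nonneg (by norm_num)).2 (by linarith)
  · rw [signOf_of_notMem (by simp [hn0, hS])] at hpos
    exact (ENNReal.ofReal_lt_ofReal_iff (by norm_num)).2 (by linarith)
end

section
/- For every d ∈ ℕ there exist a measure preserving system (X, 𝒳, μ, T) that is multiple mixing and a set A ∈ 𝒳 with 0 < μ(A) < 1 such that for every ℓ with 1 ≤ ℓ ≤ d and all pairwise distinct positive integers n₁, …, n_ℓ one has μ(A ∩ T^{−n₁}A ∩ ⋯ ∩ T^{−n_ℓ}A) < μ(A)^{ℓ+1}. Moreover, there exist (another) multiple mixing system and a set A with 0 < μ(A) < 1 satisfying the same statement with the strict inequality reversed, i.e. μ(A ∩ T^{−n₁}A ∩ ⋯ ∩ T^{−n_ℓ}A) > μ(A)^{ℓ+1} for all pairwise distinct n₁, …, n_ℓ ∈ ℕ and 1 ≤ ℓ ≤ d. -/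
open MeasureTheory Filter Topology

/-- A measure preserving system is multiple mixing if for every `ℓ` and all bounded measurable
real-valued functions `f 0, …, f ℓ`,
`∫ f 0 · (f 1 ∘ T^{n 1}) ⋯ (f ℓ ∘ T^{n ℓ}) dμ → ∏ i, ∫ f i dμ`
as `min (n 1, n 2 - n 1, …, n ℓ - n (ℓ-1)) → ∞`.  We encode the times as a function
`n : Fin (ℓ+1) → ℕ` with `n 0 = 0` and all consecutive gaps at least `N`. -/
def MultipleMixing {X : Type*} [MeasurableSpace X] (μ : Measure X) (T : X → X) : Prop :=
  ∀ (ℓ : ℕ) (f : Fin (ℓ + 1) → X → ℝ),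
    (∀ i, Measurable (f i)) → (∀ i, ∃ C : ℝ, ∀ x, |f i x| ≤ C) →
    ∀ ε > (0 : ℝ), ∃ N : ℕ, ∀ n : Fin (ℓ + 1) → ℕ, n 0 = 0 →
      (∀ i j : Fin (ℓ + 1), (i : ℕ) + 1 = (j : ℕ) → n i < n j ∧ N ≤ n j - n i) →
      |(∫ x, ∏ i, f i (T^[n i] x) ∂μ) - ∏ i, ∫ x, f i x ∂μ| < ε

open ProbabilityTheory
open scoped ENNReal

/-- The one-sided shift on sequences. -/
def seqShift {α : Type*} (x : ℕ → α) : ℕ → α := fun k => x (k + 1)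

lemma seqShift_iterate {α : Type*} (n : ℕ) (x : ℕ → α) :
    seqShift^[n] x = fun k => x (k + n) := by
  induction n generalizing x with
  | zero => rfl
  | succ n ih =>
    rw [Function.iterate_succ_apply, ih]
    funext k
    simp only [seqShift]
    congr 1

lemma seqShift_iterate_preimage_pi {α : Type*} (B : ℕ → Set α) (k : ℕ) :
    seqShift^[k] ⁻¹' Set.univ.pi B = Set.univ.pi fun m => {a | k ≤ m → a ∈ B (m - k)} := by
  ext x
  simp only [Set.mem_preimage, Set.mem_univ_pi, seqShift_iterate, Set.mem_ofPred_eq]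
  refine ⟨fun h m hm => ?_, fun h m => ?_⟩
  · have := h (m - k)
    rwa [Nat.sub_add_cancel hm] at this
  · simpa using h (m + k) (Nat.le_add_left _ _)

section Shift

variable {α : Type*} [mα : MeasurableSpace α]

lemma measurable_seqShift : Measurable (seqShift (α := α)) := by
  unfold seqShift
  fun_prop

lemma measurePreserving_seqShift (ν : Measure α) [IsProbabilityMeasure ν] :
    MeasurePreserving seqShift (Measure.infinitePi fun _ : ℕ => ν)
      (Measure.infinitePi fun _ : ℕ => ν) :=
  ⟨measurable_seqShift, Measure.map_infinitePi_infinitePi_of_inj (add_left_injective 1)⟩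

/-- The filtration on sequences generated by the initial segments of coordinates. -/
def coordFiltration (α : Type*) [MeasurableSpace α] :
    Filtration ℕ (MeasurableSpace.pi : MeasurableSpace (ℕ → α)) where
  seq i := ⨆ j ∈ Set.Iic i, MeasurableSpace.comap (fun x : ℕ → α => x j) inferInstance
  mono' _ _ hij := biSup_mono fun _ => ge_trans hij
  le' _ := iSup₂_le fun j _ => (measurable_pi_apply j).comap_le

lemma iSup_coordFiltration :
    ⨆ i, coordFiltration α i = (MeasurableSpace.pi : MeasurableSpace (ℕ → α)) := by
  refine le_antisymm (iSup_le (coordFiltration α).le) ?_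
  refine iSup_le fun j => le_trans ?_ (le_iSup _ j)
  exact le_iSup₂_of_le (f := fun k (_ : k ∈ Set.Iic j) =>
    MeasurableSpace.comap (fun x : ℕ → α => x k) mα) j (Set.mem_Iic.2 le_rfl) le_rfl

lemma indep_coordFiltration_seqShift (ν : Measure α) [IsProbabilityMeasure ν] {i n : ℕ}
    (hin : i < n) :
    Indep (coordFiltration α i) (MeasurableSpace.pi.comap (seqShift (α := α))^[n])
      (Measure.infinitePi fun _ : ℕ => ν) := by
  have h : iIndep (fun j => MeasurableSpace.comap (fun x : ℕ → α => x j) mα)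
      (Measure.infinitePi fun _ : ℕ => ν) :=
    (iIndepFun_iff_iIndep _ _ _).1
      (iIndepFun_infinitePi (P := fun _ : ℕ => ν) (X := fun _ a => a) fun _ => measurable_id)
  refine indep_of_indep_of_le_right (indep_iSup_of_disjoint
    (fun j => (measurable_pi_apply j).comap_le) h (S := Set.Iic i) (T := Set.Ioi i)
    (Set.disjoint_left.2 fun a (ha : a ≤ i) (hb : i < a) => absurd hb (not_lt.2 ha))) ?_
  rw [MeasurableSpace.pi, MeasurableSpace.comap_iSup]
  refine iSup_le fun j => ?_
  rw [MeasurableSpace.comap_comp]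
  have : (fun x : ℕ → α => x j) ∘ seqShift^[n] = fun x => x (j + n) := by
    funext x
    simp [seqShift_iterate]
  rw [this]
  exact le_iSup₂_of_le (f := fun k (_ : k ∈ Set.Ioi i) =>
    MeasurableSpace.comap (fun x : ℕ → α => x k) mα) (j + n)
    (show i < j + n by omega) le_rfl

lemma integrable_of_abs_le {X : Type*} [MeasurableSpace X] {μ : Measure X} [IsFiniteMeasure μ]
    {f : X → ℝ} (hf : Measurable f) {C : ℝ} (hC : ∀ x, |f x| ≤ C) : Integrable f μ :=
  .of_bound hf.aestronglyMeasurable C (ae_of_all _ hC)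

/-- Uniform mixing of the Bernoulli shift: the decorrelation is uniform over all bounded
functions of the far tail. -/
lemma exists_forall_abs_integral_mul_seqShift_sub_le (ν : Measure α) [IsProbabilityMeasure ν]
    {f : (ℕ → α) → ℝ} (hf : Integrable f (Measure.infinitePi fun _ : ℕ => ν))
    (hfm : Measurable f) {ε : ℝ} (hε : 0 < ε) :
    ∃ N : ℕ, ∀ n ≥ N, ∀ (F : (ℕ → α) → ℝ) (C : ℝ), Measurable F → (∀ x, |F x| ≤ C) →
      |(∫ x, f x * F (seqShift^[n] x) ∂(Measure.infinitePi fun _ : ℕ => ν))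
        - (∫ x, f x ∂(Measure.infinitePi fun _ : ℕ => ν)) *
          ∫ x, F x ∂(Measure.infinitePi fun _ : ℕ => ν)| ≤ ε * C := by
  set μ := Measure.infinitePi fun _ : ℕ => ν with hμ
  have hlim := hf.tendsto_eLpNorm_condExp (ℱ := coordFiltration α)
    (by rw [iSup_coordFiltration]; exact hfm.stronglyMeasurable)
  obtain ⟨K, hK⟩ := (hlim.eventually (gt_mem_nhds (ENNReal.ofReal_pos.2 hε))).exists
  refine ⟨K + 1, fun n hn F C hF hFC => ?_⟩
  set g := μ[f | coordFiltration α K] with hg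
  have hgi : Integrable g μ := integrable_condExp
  have hgf : ∫ x, |g x - f x| ∂μ ≤ ε := by
    have h1 := (eLpNorm_one_eq_lintegral_enorm (μ := μ) (f := g - f)) ▸ hK
    have h3 : Integrable (fun x => |g x - f x|) μ := (hgi.sub hf).abs
    rw [← ENNReal.ofReal_le_ofReal_iff hε.le,
      ofReal_integral_eq_lintegral_ofReal h3 (ae_of_all _ fun _ => abs_nonneg _)]
    refine le_trans (le_of_eq ?_) h1.le
    refine lintegral_congr fun x => ?_
    rw [Pi.sub_apply, ← ofReal_norm, Real.norm_eq_abs]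
  have hmp : MeasurePreserving (seqShift (α := α))^[n] μ μ :=
    (measurePreserving_seqShift ν).iterate n
  have hFn : Measurable fun x => F (seqShift^[n] x) := hF.comp hmp.measurable
  have hmul : ∀ {u : (ℕ → α) → ℝ}, Integrable u μ →
      Integrable (fun x => u x * F (seqShift^[n] x)) μ := fun hu =>
    hu.mul_bdd hFn.aestronglyMeasurable (ae_of_all _ fun x => hFC _)
  have hind : g ⟂ᵢ[μ] fun x => F (seqShift^[n] x) := by
    rw [IndepFun_iff_Indep]
    refine indep_of_indep_of_le (indep_coordFiltration_seqShift ν (i := K) (n := n) (by omega))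
      stronglyMeasurable_condExp.measurable.comap_le ?_
    rintro _ ⟨s, hs, rfl⟩
    exact ⟨F ⁻¹' s, hF hs, rfl⟩
  have h2 : ∫ x, g x * F (seqShift^[n] x) ∂μ = (∫ x, f x ∂μ) * ∫ x, F x ∂μ := by
    rw [hind.integral_fun_mul_eq_mul_integral hgi.aestronglyMeasurable hFn.aestronglyMeasurable,
      integral_condExp, ← integral_map hmp.measurable.aemeasurable hF.aestronglyMeasurable,
      hmp.map_eq]
  rw [← h2, ← integral_sub (hmul hf) (hmul hgi)]
  refine (abs_integral_le_integral_abs).trans ?_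
  calc ∫ x, |f x * F (seqShift^[n] x) - g x * F (seqShift^[n] x)| ∂μ
      ≤ ∫ x, |g x - f x| * C ∂μ := by
        refine integral_mono ((hmul hf).sub (hmul hgi)).abs ((hgi.sub hf).abs.mul_const C)
          fun x => ?_
        simp only
        rw [← sub_mul, abs_mul, abs_sub_comm]
        exact mul_le_mul_of_nonneg_left (hFC _) (abs_nonneg _)
    _ = (∫ x, |g x - f x| ∂μ) * C := integral_mul_const _ _
    _ ≤ ε * C := by
        have hC : 0 ≤ C := by
          obtain ⟨x⟩ := nonempty_of_isProbabilityMeasure μ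
          exact (abs_nonneg _).trans (hFC x)
        exact mul_le_mul_of_nonneg_right hgf hC

theorem multipleMixing_seqShift (ν : Measure α) [IsProbabilityMeasure ν] :
    MultipleMixing (Measure.infinitePi fun _ : ℕ => ν) seqShift := by
  set μ := Measure.infinitePi fun _ : ℕ => ν with hμ
  intro ℓ
  induction ℓ with
  | zero =>
    intro f _ _ ε hε
    refine ⟨0, fun n hn _ => ?_⟩
    simpa [hn] using hε
  | succ ℓ ih =>
    intro f hf hb ε hε
    choose C hC using hb
    have hC0 : ∀ i, 0 ≤ C i := fun i => by
      obtain ⟨x⟩ := nonempty_of_isProbabilityMeasure μ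
      exact (abs_nonneg _).trans (hC i x)
    set D := ∏ i : Fin (ℓ + 1), C i.succ with hD
    have hD0 : 0 ≤ D := Finset.prod_nonneg fun i _ => hC0 _
    set I := ∫ x, f 0 x ∂μ with hI
    obtain ⟨N₁, hN₁⟩ := exists_forall_abs_integral_mul_seqShift_sub_le ν
      (integrable_of_abs_le (hf 0) (hC 0)) (hf 0) (ε := ε / 2 / (D + 1)) (by positivity)
    obtain ⟨N₂, hN₂⟩ := ih (fun i => f i.succ) (fun i => hf _) (fun i => ⟨_, hC i.succ⟩)
      (ε / 2 / (|I| + 1)) (by positivity)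
    refine ⟨max N₁ N₂, fun n hn0 hn => ?_⟩
    have hmono : StrictMono n := Fin.strictMono_iff_lt_succ.2 fun i => (hn _ _ (by simp)).1
    set m : Fin (ℓ + 1) → ℕ := fun i => n i.succ - n (0 : Fin (ℓ + 1)).succ with hm
    have hle : ∀ i : Fin (ℓ + 1), n (0 : Fin (ℓ + 1)).succ ≤ n i.succ := fun i =>
      hmono.monotone (Fin.succ_le_succ_iff.2 (Fin.zero_le i))
    have h1 := hn 0 (0 : Fin (ℓ + 1)).succ (by simp)
    set F : (ℕ → α) → ℝ := fun x => ∏ i, f (Fin.succ i) (seqShift^[m i] x) with hF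
    have hFm : Measurable F := Finset.measurable_fun_prod _ fun i _ =>
      (hf _).comp (measurable_seqShift.iterate _)
    have hFD : ∀ x, |F x| ≤ D := fun x => by
      rw [hF, Finset.abs_prod]
      exact Finset.prod_le_prod (fun _ _ => abs_nonneg _) fun i _ => hC _ _
    have e1 := hN₁ (n (0 : Fin (ℓ + 1)).succ) (by omega) F D hFm hFD
    have e2 := hN₂ m (by simp [hm]) fun i j hij => by
      have := hn i.succ j.succ (by simpa using hij)
      have := hle i
      have := hle j
      simp only [hm]
      omega
    have e3 : ∀ x, ∏ i, f i (seqShift^[n i] x) =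
        f 0 x * F (seqShift^[n (0 : Fin (ℓ + 1)).succ] x) := by
      intro x
      rw [Fin.prod_univ_succ, hn0]
      simp only [Function.iterate_zero, id, hF, ← Function.iterate_add_apply, hm]
      congr 1
      refine Finset.prod_congr rfl fun i _ => ?_
      rw [Nat.sub_add_cancel (hle i)]
    simp_rw [e3]
    rw [Fin.prod_univ_succ, ← hI]
    set J := ∫ x, F x ∂μ
    set P := ∏ i : Fin (ℓ + 1), ∫ x, f i.succ x ∂μ
    have e4 : ε / 2 / (D + 1) * D < ε / 2 := by
      rw [div_mul_eq_mul_div, div_lt_iff₀ (by positivity)]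
      nlinarith
    have e5 : |I * J - I * P| ≤ ε / 2 := by
      rw [← mul_sub, abs_mul]
      have : |I| * |J - P| ≤ |I| * (ε / 2 / (|I| + 1)) :=
        mul_le_mul_of_nonneg_left e2.le (abs_nonneg _)
      refine this.trans ?_
      rw [← mul_div_assoc, div_le_iff₀ (by positivity)]
      nlinarith [abs_nonneg I]
    have := abs_sub_le (∫ x, f 0 x * F (seqShift^[n (0 : Fin (ℓ + 1)).succ] x) ∂μ) (I * J) (I * P)
    linarith

end Shift

section Boxes

variable {α : Type*} [mα : MeasurableSpace α] (ν : Measure α) [IsProbabilityMeasure ν]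

lemma tendsto_prod_measureReal_pi {S : ℕ → Set α} (hS : ∀ m, MeasurableSet (S m)) :
    Tendsto (fun M => ∏ m ∈ Finset.range M, ν.real (S m)) atTop
      (𝓝 ((Measure.infinitePi fun _ : ℕ => ν).real (Set.univ.pi S))) := by
  set μ := Measure.infinitePi fun _ : ℕ => ν with hμ
  have hfin : ∀ M, ∏ m ∈ Finset.range M, ν.real (S m)
      = μ.real (Set.pi (Finset.range M : Set ℕ) S) := fun M => by
    rw [measureReal_def, hμ, Measure.infinitePi_pi _ fun m _ => hS m, ENNReal.toReal_prod]
    rfl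
  have hInter : Set.univ.pi S = ⋂ M : ℕ, Set.pi (Finset.range M : Set ℕ) S := by
    ext x
    simp only [Set.mem_iInter, Set.mem_pi, Finset.coe_range, Set.mem_Iio]
    exact ⟨fun h M m _ => h m trivial, fun h m _ => h (m + 1) m (Nat.lt_succ_self m)⟩
  simp_rw [hfin]
  rw [hInter]
  refine (ENNReal.tendsto_toReal (measure_ne_top _ _)).comp
    (tendsto_measure_iInter_atTop (fun M => ?_) ?_ ⟨0, measure_ne_top _ _⟩)
  · exact (MeasurableSet.pi (Finset.countable_toSet _) fun m _ => hS m).nullMeasurableSet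
  · intro M M' h
    refine Set.pi_mono' (fun _ _ => subset_rfl) ?_
    simpa using h

lemma measurableSet_delayed {B : ℕ → Set α} (hB : ∀ k, MeasurableSet (B k)) (k m : ℕ) :
    MeasurableSet {a | k ≤ m → a ∈ B (m - k)} := by
  by_cases h : k ≤ m
  · simpa [h] using hB _
  · simp [h]

variable {ι : Type*} [Fintype ι]

lemma tendsto_prod_prod_measureReal_delayed {B : ℕ → Set α} (hB : ∀ k, MeasurableSet (B k))
    (n : ι → ℕ) :
    Tendsto (fun M => ∏ m ∈ Finset.range M, ∏ i, ν.real {a | n i ≤ m → a ∈ B (m - n i)}) atTop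
      (𝓝 ((Measure.infinitePi fun _ : ℕ => ν).real (Set.univ.pi B) ^ Fintype.card ι)) := by
  simp_rw [fun M => Finset.prod_comm (s := Finset.range M) (t := (Finset.univ : Finset ι))
    (f := fun m i => ν.real {a | n i ≤ m → a ∈ B (m - n i)})]
  have h : ∀ i, (Measure.infinitePi fun _ : ℕ => ν).real (Set.univ.pi B) =
      (Measure.infinitePi fun _ : ℕ => ν).real
        (Set.univ.pi fun m => {a | n i ≤ m → a ∈ B (m - n i)}) := fun i => by
    rw [← seqShift_iterate_preimage_pi, measureReal_def, measureReal_def,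
      ((measurePreserving_seqShift ν).iterate (n i)).measure_preimage
        (MeasurableSet.univ_pi hB).nullMeasurableSet]
  rw [← Finset.card_univ, ← Finset.prod_const, Finset.prod_congr rfl fun i _ => h i]
  exact tendsto_finsetProd _ fun i _ =>
    tendsto_prod_measureReal_pi ν fun m => measurableSet_delayed hB (n i) m

lemma tendsto_prod_measureReal_iInter_delayed {B : ℕ → Set α} (hB : ∀ k, MeasurableSet (B k))
    (n : ι → ℕ) :
    Tendsto (fun M => ∏ m ∈ Finset.range M, ν.real (⋂ i, {a | n i ≤ m → a ∈ B (m - n i)})) atTop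
      (𝓝 ((Measure.infinitePi fun _ : ℕ => ν).real (⋂ i, seqShift^[n i] ⁻¹' Set.univ.pi B))) := by
  have : ⋂ i, seqShift^[n i] ⁻¹' Set.univ.pi B =
      Set.univ.pi fun m => ⋂ i, {a | n i ≤ m → a ∈ B (m - n i)} := by
    ext x
    simp only [seqShift_iterate_preimage_pi, Set.mem_iInter, Set.mem_univ_pi]
    exact forall_comm
  rw [this]
  exact tendsto_prod_measureReal_pi ν fun m =>
    MeasurableSet.iInter fun i => measurableSet_delayed hB (n i) m

end Boxes

/-- Termwise comparison of infinite products, strict as soon as one factor is. -/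
lemma lt_of_tendsto_prod_of_le {f g : ℕ → ℝ} {a b : ℝ} (hf : ∀ m, 0 ≤ f m)
    (hfg : ∀ m, f m ≤ g m) {k : ℕ} (hk : f k < g k) (hb : 0 < b)
    (ha : Tendsto (fun M => ∏ m ∈ Finset.range M, f m) atTop (𝓝 a))
    (hb' : Tendsto (fun M => ∏ m ∈ Finset.range M, g m) atTop (𝓝 b)) : a < b := by
  have hgk : 0 < g k := (hf k).trans_lt hk
  have hle : a ≤ f k / g k * b := by
    refine le_of_tendsto_of_tendsto ha (hb'.const_mul (f k / g k)) ?_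
    filter_upwards [eventually_gt_atTop k] with M hM
    have hmem : k ∈ Finset.range M := Finset.mem_range.2 hM
    rw [← Finset.mul_prod_erase _ f hmem, ← Finset.mul_prod_erase _ g hmem, ← mul_assoc,
      div_mul_cancel₀ _ hgk.ne']
    exact mul_le_mul_of_nonneg_left (Finset.prod_le_prod (fun m _ => hf m) fun m _ => hfg m) (hf k)
  refine hle.trans_lt ?_
  have : f k / g k < 1 := (div_lt_one hgk).2 hk
  nlinarith

lemma one_sub_sum_le_prod_one_sub {ι : Type*} (s : Finset ι) {q : ι → ℝ}
    (h0 : ∀ i, 0 ≤ q i) (h1 : ∀ i, q i ≤ 1) : 1 - ∑ i ∈ s, q i ≤ ∏ i ∈ s, (1 - q i) := by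
  classical
  induction s using Finset.induction_on with
  | empty => simp
  | insert a s ha ih =>
    rw [Finset.sum_insert ha, Finset.prod_insert ha]
    have := mul_le_mul_of_nonneg_left ih (sub_nonneg.2 (h1 a))
    nlinarith [mul_nonneg (h0 a) (Finset.sum_nonneg fun i (_ : i ∈ s) => h0 i)]

lemma one_sub_sum_lt_prod_one_sub {ι : Type*} {s : Finset ι} (hs : s.Nontrivial) {q : ι → ℝ}
    (h0 : ∀ i, 0 < q i) (h1 : ∀ i, q i ≤ 1) : 1 - ∑ i ∈ s, q i < ∏ i ∈ s, (1 - q i) := by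
  classical
  obtain ⟨a, ha, b, hb, hab⟩ := hs
  rw [← Finset.add_sum_erase _ _ ha, ← Finset.mul_prod_erase _ _ ha]
  have hpos : 0 < ∑ i ∈ s.erase a, q i :=
    Finset.sum_pos (fun i _ => h0 i) ⟨b, Finset.mem_erase.2 ⟨hab.symm, hb⟩⟩
  have := mul_le_mul_of_nonneg_left
    (one_sub_sum_le_prod_one_sub (s.erase a) (fun i => (h0 i).le) h1) (sub_nonneg.2 (h1 a))
  nlinarith [mul_pos (h0 a) hpos]

lemma exists_iInter_eq_of_total {α ι : Type*} [Finite ι] {C : ι → Set α} [Nonempty ι]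
    (ht : ∀ i j, C i ⊆ C j ∨ C j ⊆ C i) :
    ∃ j, ⋂ i, C i = C j := by
  obtain ⟨j, hj⟩ := Directed.finite_le (r := (· ⊇ ·)) (f := C)
    (fun i j => (ht i j).elim (fun h => ⟨i, subset_rfl, h⟩) fun h => ⟨j, h, subset_rfl⟩) id
  exact ⟨j, (Set.iInter_subset _ j).antisymm (Set.subset_iInter hj)⟩

section Events

variable {α ι : Type*} [MeasurableSpace α] (ν : Measure α) [IsProbabilityMeasure ν] [Fintype ι]
  {C : ι → Set α}

lemma measureReal_iInter_of_disjoint_compl (hC : ∀ i, MeasurableSet (C i))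
    (hd : Pairwise (Function.onFun Disjoint fun i => (C i)ᶜ)) :
    ν.real (⋂ i, C i) = 1 - ∑ i, ν.real (C i)ᶜ := by
  rw [← compl_compl (⋂ i, C i), probReal_compl_eq_one_sub (MeasurableSet.iInter hC).compl,
    Set.compl_iInter, measureReal_iUnion_fintype hd fun i => (hC i).compl]

lemma measureReal_eq_one_sub_compl {S : Set α} (hS : MeasurableSet S) :
    ν.real S = 1 - ν.real Sᶜ := by
  rw [probReal_compl_eq_one_sub hS, sub_sub_cancel]

lemma measureReal_iInter_le_prod_of_disjoint_compl (hC : ∀ i, MeasurableSet (C i))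
    (hd : Pairwise (Function.onFun Disjoint fun i => (C i)ᶜ)) :
    ν.real (⋂ i, C i) ≤ ∏ i, ν.real (C i) := by
  rw [measureReal_iInter_of_disjoint_compl ν hC hd,
    Finset.prod_congr rfl fun i _ => measureReal_eq_one_sub_compl ν (hC i)]
  exact one_sub_sum_le_prod_one_sub _ (fun _ => measureReal_nonneg) fun _ => measureReal_le_one

lemma measureReal_iInter_lt_prod_of_disjoint_compl [Nontrivial ι]
    (hC : ∀ i, MeasurableSet (C i)) (hd : Pairwise (Function.onFun Disjoint fun i => (C i)ᶜ))
    (hpos : ∀ i, 0 < ν.real (C i)ᶜ) :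
    ν.real (⋂ i, C i) < ∏ i, ν.real (C i) := by
  rw [measureReal_iInter_of_disjoint_compl ν hC hd,
    Finset.prod_congr rfl fun i _ => measureReal_eq_one_sub_compl ν (hC i)]
  exact one_sub_sum_lt_prod_one_sub Finset.univ_nontrivial hpos fun _ => measureReal_le_one

lemma prod_le_measureReal_iInter_of_total [Nonempty ι] (ht : ∀ i j, C i ⊆ C j ∨ C j ⊆ C i) :
    ∏ i, ν.real (C i) ≤ ν.real (⋂ i, C i) := by
  classical
  obtain ⟨j, hj⟩ := exists_iInter_eq_of_total ht
  rw [hj, ← Finset.mul_prod_erase _ _ (Finset.mem_univ j)]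
  exact mul_le_of_le_one_right measureReal_nonneg
    (Finset.prod_le_one (fun _ _ => measureReal_nonneg) fun _ _ => measureReal_le_one)

lemma prod_lt_measureReal_iInter_of_total [Nontrivial ι] (ht : ∀ i j, C i ⊆ C j ∨ C j ⊆ C i)
    (hpos : ∀ i, 0 < ν.real (C i)) (hlt : ∀ i, ν.real (C i) < 1) :
    ∏ i, ν.real (C i) < ν.real (⋂ i, C i) := by
  classical
  obtain ⟨j, hj⟩ := exists_iInter_eq_of_total ht
  obtain ⟨k, hk⟩ := exists_ne j
  rw [hj, ← Finset.mul_prod_erase _ _ (Finset.mem_univ j)]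
  refine mul_lt_of_lt_one_right (hpos j) ?_
  rw [← Finset.mul_prod_erase _ _ (Finset.mem_erase.2 ⟨hk, Finset.mem_univ k⟩)]
  exact mul_lt_one_of_nonneg_of_lt_one_left measureReal_nonneg (hlt k)
    (Finset.prod_le_one (fun _ _ => measureReal_nonneg) fun _ _ => measureReal_le_one)

end Events

lemma measureReal_delayed_compl {ν : Measure ℕ} {B : ℕ → Set ℕ}
    (hB : ∀ k, ν.real (B k)ᶜ = (1 / 2) ^ (k + 2)) {k m : ℕ} (hk : k ≤ m) :
    ν.real {a | k ≤ m → a ∈ B (m - k)}ᶜ = (1 / 2) ^ (m - k + 2) := by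
  simpa [hk] using hB (m - k)

section Recurrence

variable {ν : Measure ℕ} [IsProbabilityMeasure ν] {B : ℕ → Set ℕ}

lemma measureReal_pi_pos (hB : ∀ k, ν.real (B k)ᶜ = (1 / 2) ^ (k + 2)) :
    0 < (Measure.infinitePi fun _ : ℕ => ν).real (Set.univ.pi B) := by
  have h : ∀ k, ν.real (B k) = 1 - (1 / 2) ^ (k + 2) := fun k => by
    rw [measureReal_eq_one_sub_compl ν (MeasurableSet.of_discrete), hB]
  have hge : (1 / 2 : ℝ) ≤ (Measure.infinitePi fun _ : ℕ => ν).real (Set.univ.pi B) := by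
    refine ge_of_tendsto' (tendsto_prod_measureReal_pi ν fun m => MeasurableSet.of_discrete)
      fun M => ?_
    simp_rw [h]
    refine le_trans ?_ (one_sub_sum_le_prod_one_sub _ (fun _ => by positivity)
      fun k => pow_le_one₀ (by norm_num) (by norm_num))
    have : ∑ k ∈ Finset.range M, (1 / 2 : ℝ) ^ (k + 2) = 1 / 2 - (1 / 2) ^ (M + 1) := by
      induction M with
      | zero => norm_num
      | succ M ih => rw [Finset.sum_range_succ, ih]; ring
    rw [this]
    have : (0 : ℝ) < (1 / 2) ^ (M + 1) := by positivity
    linarith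
  linarith

lemma measureReal_pi_lt_one (hB : ∀ k, ν.real (B k)ᶜ = (1 / 2) ^ (k + 2)) :
    (Measure.infinitePi fun _ : ℕ => ν).real (Set.univ.pi B) < 1 := by
  set μ := Measure.infinitePi fun _ : ℕ => ν
  have h1 : μ.real (Set.univ.pi B) ≤ μ.real ((fun x => x 0) ⁻¹' B 0) :=
    measureReal_mono fun x hx => hx 0 (Set.mem_univ _)
  have h2 : μ.real ((fun x => x 0) ⁻¹' B 0) = ν.real (B 0) := by
    rw [measureReal_def, measureReal_def]
    exact congrArg _ ((measurePreserving_eval_infinitePi (fun _ : ℕ => ν) 0).measure_preimage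
      MeasurableSet.of_discrete.nullMeasurableSet)
  have h3 := measureReal_eq_one_sub_compl ν (MeasurableSet.of_discrete (s := B 0))
  rw [hB] at h3
  norm_num at h3
  linarith

variable {ι : Type*} [Fintype ι] [Nontrivial ι] {n : ι → ℕ}

/-- If the forbidden values `(B k)ᶜ` are pairwise disjoint, the box is under-recurrent. -/
lemma measureReal_iInter_lt_pow (hB : ∀ k, ν.real (B k)ᶜ = (1 / 2) ^ (k + 2))
    (hd : Pairwise (Function.onFun Disjoint fun k => (B k)ᶜ))
    (hn : Function.Injective n) :
    (Measure.infinitePi fun _ : ℕ => ν).real (⋂ i, seqShift^[n i] ⁻¹' Set.univ.pi B) <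
      (Measure.infinitePi fun _ : ℕ => ν).real (Set.univ.pi B) ^ Fintype.card ι := by
  have hd' : ∀ m, Pairwise (Function.onFun Disjoint
      fun i => {a | n i ≤ m → a ∈ B (m - n i)}ᶜ) := fun m i j hij => by
    refine Set.disjoint_left.2 fun a hi hj => ?_
    simp only [Set.mem_compl_iff, Set.mem_ofPred_eq, Classical.not_imp] at hi hj
    refine Set.disjoint_left.1 (hd (i := m - n i) (j := m - n j) ?_) hi.2 hj.2
    have := hn.ne hij
    omega
  refine lt_of_tendsto_prod_of_le (k := Finset.univ.sup n) (fun _ => measureReal_nonneg)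
    (fun m => measureReal_iInter_le_prod_of_disjoint_compl ν
      (fun _ => MeasurableSet.of_discrete) (hd' m))
    (measureReal_iInter_lt_prod_of_disjoint_compl ν
      (fun _ => MeasurableSet.of_discrete) (hd' _) fun i => ?_)
    (pow_pos (measureReal_pi_pos hB) _)
    (tendsto_prod_measureReal_iInter_delayed ν (fun _ => MeasurableSet.of_discrete) n)
    (tendsto_prod_prod_measureReal_delayed ν (fun _ => MeasurableSet.of_discrete) n)
  rw [measureReal_delayed_compl hB (Finset.le_sup (Finset.mem_univ i))]
  positivity

/-- If the allowed values `B k` increase with `k`, the box is over-recurrent. -/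
lemma pow_lt_measureReal_iInter (hB : ∀ k, ν.real (B k)ᶜ = (1 / 2) ^ (k + 2))
    (hm : Monotone B) :
    (Measure.infinitePi fun _ : ℕ => ν).real (Set.univ.pi B) ^ Fintype.card ι <
      (Measure.infinitePi fun _ : ℕ => ν).real (⋂ i, seqShift^[n i] ⁻¹' Set.univ.pi B) := by
  have ht : ∀ m i j, {a | n i ≤ m → a ∈ B (m - n i)} ⊆ {a | n j ≤ m → a ∈ B (m - n j)} ∨
      {a | n j ≤ m → a ∈ B (m - n j)} ⊆ {a | n i ≤ m → a ∈ B (m - n i)} := by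
    have key : ∀ m k l, k ≤ l →
        {a | l ≤ m → a ∈ B (m - l)} ⊆ {a | k ≤ m → a ∈ B (m - k)} ∨ m < l := by
      intro m k l hkl
      refine (lt_or_ge m l).elim .inr fun h => .inl fun a ha _ => hm ?_ (ha h)
      omega
    have key' : ∀ m k l, k ≤ l →
        {a | l ≤ m → a ∈ B (m - l)} ⊆ {a | k ≤ m → a ∈ B (m - k)} ∨
        {a | k ≤ m → a ∈ B (m - k)} ⊆ {a | l ≤ m → a ∈ B (m - l)} := fun m k l hkl =>
      (key m k l hkl).imp_right fun h _ _ h' => absurd h (not_lt.2 h')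
    exact fun m i j => (le_total (n i) (n j)).elim (fun h => (key' m _ _ h).symm) (key' m _ _)
  have hA := pow_pos (measureReal_pi_pos hB) (Fintype.card ι)
  have hlim := tendsto_prod_prod_measureReal_delayed ν (B := B)
    (fun _ => MeasurableSet.of_discrete) n
  have hlim' := tendsto_prod_measureReal_iInter_delayed ν (B := B)
    (fun _ => MeasurableSet.of_discrete) n
  have hle := fun m => prod_le_measureReal_iInter_of_total ν (ht m)
  have hq : ∀ i, ν.real {a | n i ≤ Finset.univ.sup n → a ∈ B (Finset.univ.sup n - n i)} =
      1 - (1 / 2) ^ (Finset.univ.sup n - n i + 2) := fun i => by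
    rw [measureReal_eq_one_sub_compl ν MeasurableSet.of_discrete,
      measureReal_delayed_compl hB (Finset.le_sup (Finset.mem_univ i))]
  refine lt_of_tendsto_prod_of_le (k := Finset.univ.sup n)
    (fun _ => Finset.prod_nonneg fun _ _ => measureReal_nonneg) hle
    (prod_lt_measureReal_iInter_of_total ν (ht _) (fun i => ?_) fun i => ?_)
    (hA.trans_le (le_of_tendsto_of_tendsto' hlim hlim' fun M =>
      Finset.prod_le_prod (fun _ _ => Finset.prod_nonneg fun _ _ => measureReal_nonneg)
        fun m _ => hle m)) hlim hlim'
  · rw [hq, sub_pos]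
    exact pow_lt_one₀ (by norm_num) (by norm_num) (by omega)
  · rw [hq, sub_lt_self_iff]
    positivity

end Recurrence

lemma inter_iInter_eq_iInter_cons {X : Type*} (T : X → X) (A : Set X) {ℓ : ℕ} (n : Fin ℓ → ℕ) :
    A ∩ ⋂ i, T^[n i] ⁻¹' A
      = ⋂ i, T^[(Fin.cons 0 n : Fin (ℓ + 1) → ℕ) i] ⁻¹' A := by
  ext x
  simp [Fin.forall_fin_succ]

lemma injective_cons_zero {ℓ : ℕ} {n : Fin ℓ → ℕ} (hpos : ∀ i, 1 ≤ n i)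
    (hn : Function.Injective n) : Function.Injective (Fin.cons 0 n : Fin (ℓ + 1) → ℕ) := by
  refine Fin.cons_injective_iff.2 ⟨?_, hn⟩
  rintro ⟨i, hi⟩
  have := hpos i
  omega

lemma exists_measure_singleton_eq_pow :
    ∃ ν : Measure ℕ, IsProbabilityMeasure ν ∧ ∀ j, ν.real {j} = (1 / 2) ^ (j + 1) := by
  refine ⟨geometricMeasure ⟨1 / 2, by norm_num, by norm_num⟩, inferInstance, fun j => ?_⟩
  rw [geometricMeasure_real_singleton (fun h => by simpa using congrArg Subtype.val h)]
  norm_num [pow_succ]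

theorem stmt_3 (d : ℕ) :
    (∃ (X : Type) (_ : MeasurableSpace X) (μ : Measure X) (T : X → X),
      IsProbabilityMeasure μ ∧ Measurable T ∧ MeasurePreserving T μ μ ∧
      MultipleMixing μ T ∧
      ∃ A : Set X, MeasurableSet A ∧ 0 < μ A ∧ μ A < 1 ∧
        ∀ ℓ : ℕ, 1 ≤ ℓ → ℓ ≤ d → ∀ n : Fin ℓ → ℕ,
          (∀ i, 1 ≤ n i) → Function.Injective n →
          μ (A ∩ ⋂ i, T^[n i] ⁻¹' A) < μ A ^ (ℓ + 1)) ∧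
    (∃ (X : Type) (_ : MeasurableSpace X) (μ : Measure X) (T : X → X),
      IsProbabilityMeasure μ ∧ Measurable T ∧ MeasurePreserving T μ μ ∧
      MultipleMixing μ T ∧
      ∃ A : Set X, MeasurableSet A ∧ 0 < μ A ∧ μ A < 1 ∧
        ∀ ℓ : ℕ, 1 ≤ ℓ → ℓ ≤ d → ∀ n : Fin ℓ → ℕ,
          (∀ i, 1 ≤ n i) → Function.Injective n →
          μ (A ∩ ⋂ i, T^[n i] ⁻¹' A) > μ A ^ (ℓ + 1)) := by
  obtain ⟨ν, hν, hsing⟩ := exists_measure_singleton_eq_pow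
  set μ := Measure.infinitePi fun _ : ℕ => ν
  have hpos : ∀ {B : ℕ → Set ℕ}, (∀ k, ν.real (B k)ᶜ = (1 / 2) ^ (k + 2)) →
      0 < μ (Set.univ.pi B) := fun hB =>
    (ENNReal.toReal_pos_iff.1 (measureReal_pi_pos hB)).1
  have hlt : ∀ {B : ℕ → Set ℕ}, (∀ k, ν.real (B k)ᶜ = (1 / 2) ^ (k + 2)) →
      μ (Set.univ.pi B) < 1 := fun hB =>
    (ENNReal.toReal_lt_toReal (measure_ne_top _ _) ENNReal.one_ne_top).1
      (by rw [ENNReal.toReal_one]; exact measureReal_pi_lt_one hB)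
  have hmeas : ∀ B : ℕ → Set ℕ, MeasurableSet (Set.univ.pi B) := fun B =>
    MeasurableSet.univ_pi fun _ => .of_discrete
  constructor
  · have hB : ∀ k, ν.real (({k + 1}ᶜ : Set ℕ))ᶜ = (1 / 2) ^ (k + 2) := fun k => by
      rw [compl_compl, hsing]
    refine ⟨ℕ → ℕ, inferInstance, μ, seqShift, inferInstance, measurable_seqShift,
      measurePreserving_seqShift ν, multipleMixing_seqShift ν, _, hmeas _, hpos hB, hlt hB,
      fun ℓ hℓ _ n hn1 hn => ?_⟩
    have : Nontrivial (Fin (ℓ + 1)) := Fin.nontrivial_iff_two_le.2 (by omega)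
    rw [inter_iInter_eq_iInter_cons, ← ENNReal.toReal_lt_toReal (measure_ne_top _ _)
      (ENNReal.pow_ne_top (measure_ne_top _ _)), ENNReal.toReal_pow]
    simpa [measureReal_def] using measureReal_iInter_lt_pow hB
      (fun i j hij => by simpa [Function.onFun] using hij) (injective_cons_zero hn1 hn)
  · have hB : ∀ k, ν.real (Set.Iic (k + 1))ᶜ = (1 / 2) ^ (k + 2) := fun k => by
      have h : ∀ k : ℕ, ν.real (Set.Iic k) = 1 - (1 / 2) ^ (k + 1) := fun k => by
        induction k with
        | zero =>
          rw [show Set.Iic 0 = ({0} : Set ℕ) by ext; simp, hsing]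
          norm_num
        | succ k ih =>
          rw [show Set.Iic (k + 1) = Set.Iic k ∪ {k + 1} by ext; simp; omega,
            measureReal_union (by simp) .of_discrete, ih, hsing]
          ring
      rw [probReal_compl_eq_one_sub .of_discrete, h, sub_sub_cancel]
    refine ⟨ℕ → ℕ, inferInstance, μ, seqShift, inferInstance, measurable_seqShift,
      measurePreserving_seqShift ν, multipleMixing_seqShift ν, _, hmeas _, hpos hB, hlt hB,
      fun ℓ hℓ _ n _ _ => ?_⟩
    have : Nontrivial (Fin (ℓ + 1)) := Fin.nontrivial_iff_two_le.2 (by omega)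
    rw [inter_iInter_eq_iInter_cons, gt_iff_lt, ← ENNReal.toReal_lt_toReal
      (ENNReal.pow_ne_top (measure_ne_top _ _)) (measure_ne_top _ _), ENNReal.toReal_pow]
    simpa [measureReal_def] using pow_lt_measureReal_iInter (n := Fin.cons 0 n) hB
      fun i j hij => Set.Iic_subset_Iic.2 (Nat.succ_le_succ hij)
end

section
/- Let (a_n)_{n≥1} be a real valued sequence with ∑_{n=1}^∞ |a_n| < 1/16. Then there exist a measure preserving system (X, 𝒳, μ, T) and a set A ∈ 𝒳 such that μ(A ∩ T⁻ⁿA) − μ(A)² = a_n for every n ≥ 1. -/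
open MeasureTheory Filter Topology

/-- Restricting an i.i.d. family along an injective map of index sets gives an i.i.d. family. -/
theorem map_comp_infinitePi_of_injective {ι κ Ω : Type*} [MeasurableSpace Ω] (P : Measure Ω)
    [IsProbabilityMeasure P] {e : κ → ι} (he : Function.Injective e) :
    (Measure.infinitePi fun _ : ι => P).map (fun ω i => ω (e i)) = Measure.infinitePi fun _ : κ => P := by
  classical
  refine Measure.eq_infinitePi _ fun s t ht => ?_
  have hpre : (fun (ω : ι → Ω) i => ω (e i)) ⁻¹' Set.pi s t =
      Set.pi (s.map ⟨e, he⟩) (Function.extend e t fun _ => Set.univ) := by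
    ext ω
    simp [Set.mem_pi, he.extend_apply]
  rw [Measure.map_apply (measurable_pi_lambda _ fun i => measurable_pi_apply (e i))
      (MeasurableSet.pi s.countable_toSet fun i _ => ht i), hpre, Measure.infinitePi_pi]
  · simp [he.extend_apply]
  · intro i hi
    obtain ⟨k, -, rfl⟩ := Finset.mem_map.1 hi
    simpa [he.extend_apply] using ht k

/-- The law of an i.i.d. sequence of uniformly distributed pairs of bits. -/
noncomputable def bitPairLaw : Measure (ℕ → Bool × Bool) :=
  Measure.infinitePi fun _ => ProbabilityTheory.uniformOn Set.univ

instance isProbabilityMeasure_uniformOn_bitPair :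
    IsProbabilityMeasure (ProbabilityTheory.uniformOn (Set.univ : Set (Bool × Bool))) :=
  ProbabilityTheory.isProbabilityMeasure_uniformOn Set.finite_univ Set.univ_nonempty

instance isProbabilityMeasure_bitPairLaw : IsProbabilityMeasure bitPairLaw := by
  unfold bitPairLaw; infer_instance

/-- The probability of an event depending on finitely many coordinates is found by counting. -/
theorem bitPairLaw_real_comp_preimage {k : ℕ} {e : Fin k → ℕ} (he : Function.Injective e)
    (s : Finset (Fin k → Bool × Bool)) :
    bitPairLaw.real {ω | ω ∘ e ∈ s} = s.card / 4 ^ k := by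
  have h := map_comp_infinitePi_of_injective
    (ProbabilityTheory.uniformOn (Set.univ : Set (Bool × Bool))) he
  have hm : Measurable fun (ω : ℕ → Bool × Bool) i => ω (e i) :=
    measurable_pi_lambda _ fun i => measurable_pi_apply (e i)
  have h2 : bitPairLaw.real {ω | ω ∘ e ∈ s} =
      (bitPairLaw.map fun ω i => ω (e i)).real (s : Set (Fin k → Bool × Bool)) :=
    (map_measureReal_apply hm s.measurableSet).symm
  rw [h2, bitPairLaw, h, ← sum_measureReal_singleton]
  have h1 : ∀ f : Fin k → Bool × Bool, (Measure.infinitePi fun _ : Fin k =>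
      ProbabilityTheory.uniformOn (Set.univ : Set (Bool × Bool))).real {f} = (1 / 4) ^ k := by
    intro f
    rw [Measure.real, Measure.infinitePi_singleton_of_fintype]
    simp [ProbabilityTheory.uniformOn_univ]
  simp [h1, div_eq_mul_inv]

/-- A two-variable rule on pairs of bits. For `c = true` the rule correlates positively, for
`c = false` negatively, with a copy of itself that shares one variable. -/
def bitRule (c : Bool) (u v : Bool × Bool) : Bool :=
  if (u.1 == v.1) = c then u.1 else v.2

theorem bitPairLaw_real_bitRule (c : Bool) (n : ℕ) :
    bitPairLaw.real {ω | bitRule c (ω 0) (ω n) = true} = 1 / 2 := by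
  rcases Nat.eq_zero_or_pos n with rfl | hn
  · have he : Function.Injective ![0] := Function.injective_of_subsingleton _
    have h := bitPairLaw_real_comp_preimage he
      (Finset.univ.filter fun f => bitRule c (f 0) (f 0) = true)
    have hc : (Finset.univ.filter fun f : Fin 1 → Bool × Bool =>
        bitRule c (f 0) (f 0) = true).card = 2 := by
      clear h; revert c; decide +kernel
    rw [hc] at h
    simp at h
    rw [h]; norm_num
  · have he : Function.Injective ![0, n] := by
      intro i j; fin_cases i <;> fin_cases j <;> simp <;> omega
    have h := bitPairLaw_real_comp_preimage he
      (Finset.univ.filter fun f => bitRule c (f 0) (f 1) = true)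
    have hc : (Finset.univ.filter fun f : Fin 2 → Bool × Bool =>
        bitRule c (f 0) (f 1) = true).card = 8 := by
      clear h; revert c; decide +kernel
    rw [hc] at h
    simp at h
    rw [h]; norm_num

theorem bitPairLaw_real_bitRule_inter (c : Bool) (n : ℕ) {m : ℕ} (hm : 1 ≤ m) :
    bitPairLaw.real {ω | bitRule c (ω 0) (ω n) = true ∧ bitRule c (ω m) (ω (n + m)) = true} =
      1 / 4 + if n = m then (if c then 1 / 16 else -1 / 16) else 0 := by
  rcases Nat.eq_zero_or_pos n with rfl | hn
  · have he : Function.Injective ![0, m] := by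
      intro i j; fin_cases i <;> fin_cases j <;> simp <;> omega
    have h := bitPairLaw_real_comp_preimage he (Finset.univ.filter fun f =>
      bitRule c (f 0) (f 0) = true ∧ bitRule c (f 1) (f 1) = true)
    have hc : (Finset.univ.filter fun f : Fin 2 → Bool × Bool =>
        bitRule c (f 0) (f 0) = true ∧ bitRule c (f 1) (f 1) = true).card = 4 := by
      clear h; revert c; decide +kernel
    rw [hc] at h
    simp at h
    rw [if_neg (by omega), Nat.zero_add, h]; norm_num
  by_cases hnm : n = m
  · subst hnm
    have he : Function.Injective ![0, n, n + n] := by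
      intro i j; fin_cases i <;> fin_cases j <;> simp <;> omega
    have h := bitPairLaw_real_comp_preimage he (Finset.univ.filter fun f =>
      bitRule c (f 0) (f 1) = true ∧ bitRule c (f 1) (f 2) = true)
    have hc : (Finset.univ.filter fun f : Fin 3 → Bool × Bool =>
        bitRule c (f 0) (f 1) = true ∧ bitRule c (f 1) (f 2) = true).card =
          if c then 20 else 12 := by
      clear h; revert c; decide +kernel
    rw [hc] at h
    simp at h
    rw [h]; cases c <;> norm_num
  · have he : Function.Injective ![0, n, m, n + m] := by
      intro i j; fin_cases i <;> fin_cases j <;> simp <;> omega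
    have h := bitPairLaw_real_comp_preimage he (Finset.univ.filter fun f =>
      bitRule c (f 0) (f 1) = true ∧ bitRule c (f 2) (f 3) = true)
    have hc : (Finset.univ.filter fun f : Fin 4 → Bool × Bool =>
        bitRule c (f 0) (f 1) = true ∧ bitRule c (f 2) (f 3) = true).card = 64 := by
      clear h; revert c; decide +kernel
    rw [hc] at h
    simp at h
    rw [if_neg hnm, h]; norm_num

theorem measurePreserving_shift_bitPairLaw :
    MeasurePreserving (fun ω : ℕ → Bool × Bool => ω ∘ Nat.succ) bitPairLaw bitPairLaw :=
  ⟨measurable_pi_lambda _ fun i => measurable_pi_apply (Nat.succ i),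
    map_comp_infinitePi_of_injective _ Nat.succ_injective⟩

/-- A sequence with absolute sum at most one over the positive indices is dominated by the masses
of a probability measure on `ℕ`, with equality away from zero. -/
theorem exists_isProbabilityMeasure_real_singleton (b : ℕ → ℝ)
    (hsum : Summable fun n : ℕ => |b (n + 1)|) (hle : ∑' n : ℕ, |b (n + 1)| ≤ 1) :
    ∃ ν : Measure ℕ, IsProbabilityMeasure ν ∧ ∀ n, 1 ≤ n → ν.real {n} = |b n| := by
  let p : ℕ → ℝ := fun n => Nat.casesOn n (1 - ∑' k : ℕ, |b (k + 1)|) fun k => |b (k + 1)|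
  have hp0 : ∀ n, 0 ≤ p n := by
    rintro (_ | n)
    · exact sub_nonneg.2 hle
    · exact abs_nonneg _
  have hp : HasSum p 1 := by
    rw [← hasSum_nat_add_iff' 1]
    simpa [p] using hsum.hasSum
  let q : PMF ℕ := ⟨fun n => ENNReal.ofReal (p n), by
    have h := ENNReal.ofReal_tsum_of_nonneg hp0 hp.summable
    rw [hp.tsum_eq, ENNReal.ofReal_one] at h
    rw [h]
    exact ENNReal.summable.hasSum⟩
  refine ⟨q.toMeasure, inferInstance, fun n hn => ?_⟩
  obtain ⟨k, rfl⟩ := Nat.exists_eq_add_of_le' hn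
  rw [Measure.real, PMF.toMeasure_apply_singleton _ _ (measurableSet_singleton _)]
  exact ENNReal.toReal_ofReal (hp0 (k + 1))

theorem measureReal_prod_eq_integral {α β : Type*} [MeasurableSpace α] [MeasurableSpace β]
    (ν : Measure α) (μ : Measure β) [IsFiniteMeasure μ] {s : Set (α × β)} (hs : MeasurableSet s) :
    (ν.prod μ).real s = ∫ x, μ.real (Prod.mk x ⁻¹' s) ∂ν := by
  rw [Measure.real, Measure.prod_apply hs]
  exact (integral_toReal (measurable_measure_prodMk_left hs).aemeasurable
    (ae_of_all _ fun x => measure_lt_top _ _)).symm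

theorem stmt_4 (a : ℕ → ℝ)
    (hsum : Summable fun n : ℕ => |a (n + 1)|)
    (hlt : (∑' n : ℕ, |a (n + 1)|) < 1 / 16) :
    ∃ (X : Type) (_ : MeasurableSpace X) (μ : Measure X) (T : X → X),
      IsProbabilityMeasure μ ∧ Measurable T ∧ MeasurePreserving T μ μ ∧
      ∃ A : Set X, MeasurableSet A ∧
        ∀ n : ℕ, 1 ≤ n → (μ (A ∩ T^[n] ⁻¹' A)).toReal - (μ A).toReal ^ 2 = a n := by
  obtain ⟨ν, hν, hνs⟩ := exists_isProbabilityMeasure_real_singleton (fun n => 16 * a n)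
    (by simpa [abs_mul] using hsum.mul_left 16)
    (by simp only [abs_mul, tsum_mul_left]; norm_num; linarith)
  have hT : MeasurePreserving (Prod.map id fun ω : ℕ → Bool × Bool => ω ∘ Nat.succ)
      (ν.prod bitPairLaw) (ν.prod bitPairLaw) :=
    (MeasurePreserving.id ν).prod measurePreserving_shift_bitPairLaw
  set T : ℕ × (ℕ → Bool × Bool) → ℕ × (ℕ → Bool × Bool) :=
    Prod.map id fun ω => ω ∘ Nat.succ with hTdef
  have hTn : ∀ m x, T^[m] x = (x.1, fun i => x.2 (i + m)) := by
    intro m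
    induction m with
    | zero => intro x; rfl
    | succ m ih =>
      intro x
      rw [Function.iterate_succ_apply, ih]
      simp [hTdef, Nat.succ_eq_add_one, add_assoc]
  let A : Set (ℕ × (ℕ → Bool × Bool)) :=
    {x | bitRule (decide (0 ≤ a x.1)) (x.2 0) (x.2 x.1) = true}
  have hA : MeasurableSet A := by
    have : A = ⋃ n : ℕ, {n} ×ˢ ((fun ω : ℕ → Bool × Bool => (ω 0, ω n)) ⁻¹'
        {y | bitRule (decide (0 ≤ a n)) y.1 y.2 = true}) := by
      ext ⟨n, ω⟩
      simp [A]
    rw [this]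
    refine MeasurableSet.iUnion fun n => (measurableSet_singleton n).prod ?_
    exact ((measurable_pi_apply 0).prodMk (measurable_pi_apply n)) (Set.toFinite _).measurableSet
  refine ⟨_, inferInstance, ν.prod bitPairLaw, T, inferInstance, hT.measurable, hT, A, hA,
    fun m hm => ?_⟩
  change (ν.prod bitPairLaw).real _ - (ν.prod bitPairLaw).real A ^ 2 = a m
  rw [measureReal_prod_eq_integral _ _ hA, measureReal_prod_eq_integral _ _
    (hA.inter ((hT.measurable.iterate m) hA))]
  have h1 : ∀ n, bitPairLaw.real (Prod.mk n ⁻¹' A) = 1 / 2 := fun n =>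
    bitPairLaw_real_bitRule (decide (0 ≤ a n)) n
  have h2 : ∀ n, bitPairLaw.real (Prod.mk n ⁻¹' (A ∩ T^[m] ⁻¹' A)) =
      1 / 4 + Set.indicator {m} (fun _ => if 0 ≤ a m then 1 / 16 else -1 / 16) n := by
    intro n
    have h := bitPairLaw_real_bitRule_inter (decide (0 ≤ a n)) n hm
    have hset : Prod.mk n ⁻¹' (A ∩ T^[m] ⁻¹' A) =
        {ω | bitRule (decide (0 ≤ a n)) (ω 0) (ω n) = true ∧
          bitRule (decide (0 ≤ a n)) (ω m) (ω (n + m)) = true} := by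
      ext ω
      simp [A, hTn]
    rw [hset, h]
    by_cases hnm : n = m
    · subst hnm; simp
    · simp [hnm]
  simp only [h1, h2]
  rw [integral_add (integrable_const _)
      ((integrable_const _).indicator (measurableSet_singleton m)),
    integral_indicator_const _ (measurableSet_singleton m), hνs m hm]
  simp only [integral_const, probReal_univ, smul_eq_mul, abs_mul]
  norm_num
  split_ifs with h
  · rw [abs_of_nonneg h]; ring
  · rw [abs_of_neg (not_le.1 h)]; ring
end

section
/- Let (a_n)_{n≥1} be a real valued sequence that decreases convexly to 0 and satisfies a₁ ≤ 1/8. Then there exist a measure preserving system (X, 𝒳, μ, T) and a set A ∈ 𝒳 such that μ(A ∩ T⁻ⁿA) − μ(A)² = a_n for every n ≥ 1. -/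
open MeasureTheory Filter Topology

/-- Rotate the remaining time `r ∈ {0, …, k}` of a block of length `k + 1`. -/
def blockRotation : ℕ × ℕ ≃ ℕ × ℕ where
  toFun p := (p.1, if p.2 = 0 then p.1 else if p.2 ≤ p.1 then p.2 - 1 else p.2)
  invFun p := (p.1, if p.2 = p.1 then 0 else if p.2 < p.1 then p.2 + 1 else p.2)
  left_inv := by rintro ⟨k, r⟩; grind
  right_inv := by rintro ⟨k, r⟩; grind

/-- The rotation of the blocks, together with a shift of the signs at each new block. -/
def blockMap (x : (ℕ × ℕ) × (ℕ → Bool)) : (ℕ × ℕ) × (ℕ → Bool) :=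
  (blockRotation x.1, if x.1.2 = 0 then fun i => x.2 (i + 1) else x.2)

/-- The law of independent fair signs. -/
noncomputable def fairSigns : Measure (ℕ → Bool) :=
  Measure.infinitePi fun _ => (PMF.uniformOfFintype Bool).toMeasure

instance : IsProbabilityMeasure fairSigns := by unfold fairSigns; infer_instance

/-- The mass of a pair (block, remaining time): `e k` at each of the `k + 1` positions in block `k`. -/
noncomputable def blockWeight (e : ℕ → ℝ) (p : ℕ × ℕ) : ENNReal :=
  if p.2 ≤ p.1 then ENNReal.ofReal (e p.1) else 0

/-- The discrete measure with weights `blockWeight e`. -/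
noncomputable def blockMeasure (e : ℕ → ℝ) : Measure (ℕ × ℕ) :=
  Measure.sum fun p => blockWeight e p • Measure.dirac p

theorem uniformOfFintype_bool_singleton (b : Bool) : (PMF.uniformOfFintype Bool).toMeasure {b} = 2⁻¹ := by
  rw [PMF.toMeasure_apply_singleton _ _ (by simp)]; simp

theorem fairSigns_single : fairSigns {ω | ω 0 = true} = 2⁻¹ := by
  have h := Measure.infinitePi_pi (fun _ : ℕ => (PMF.uniformOfFintype Bool).toMeasure)
    (s := {0}) (t := fun _ => {true}) (by simp)
  rw [Finset.prod_const, uniformOfFintype_bool_singleton] at h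
  convert h using 2 <;> simp [fairSigns, Set.pi]

theorem fairSigns_pair {m : ℕ} (hm : m ≠ 0) :
    fairSigns {ω | ω 0 = true ∧ ω m = true} = 4⁻¹ := by
  have h := Measure.infinitePi_pi (fun _ : ℕ => (PMF.uniformOfFintype Bool).toMeasure)
    (s := {0, m}) (t := fun _ => {true}) (by simp)
  rw [Finset.prod_const, uniformOfFintype_bool_singleton, Finset.card_pair hm.symm] at h
  have hs : {ω : ℕ → Bool | ω 0 = true ∧ ω m = true} =
      Set.pi ({0, m} : Finset ℕ) fun _ => {true} := by ext ω; simp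
  rw [hs, fairSigns, h, ← ENNReal.inv_pow]
  norm_num

theorem fairSigns_map_shift : fairSigns.map (fun ω i => ω (i + 1)) = fairSigns := by
  have hmeas : Measurable (fun (ω : ℕ → Bool) i => ω (i + 1)) := by fun_prop
  refine Measure.eq_infinitePi _ fun s t ht => ?_
  rw [Measure.map_apply hmeas (.pi s.countable_toSet fun i _ => ht i)]
  have h := Measure.infinitePi_pi (fun _ : ℕ => (PMF.uniformOfFintype Bool).toMeasure)
    (s := s.map (addRightEmbedding 1)) (t := fun i => t (i - 1)) (by simp)
  rw [Finset.prod_map] at h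
  have hs : (fun (ω : ℕ → Bool) i => ω (i + 1)) ⁻¹' (s : Set ℕ).pi t =
      ((s.map (addRightEmbedding 1) : Finset ℕ) : Set ℕ).pi fun i => t (i - 1) := by
    ext ω; simp [Set.mem_pi]
  rw [hs, fairSigns, h]
  simp

theorem blockMeasure_preserving (e : ℕ → ℝ) :
    MeasurePreserving blockRotation (blockMeasure e) (blockMeasure e) := by
  refine ⟨measurable_of_countable _, ?_⟩
  ext s hs
  rw [Measure.map_apply (measurable_of_countable _) hs]
  simp only [blockMeasure, Measure.sum_apply_of_countable, Measure.smul_apply, smul_eq_mul]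
  rw [← blockRotation.tsum_eq fun p => blockWeight e p * Measure.dirac p s]
  refine tsum_congr fun p => ?_
  congr 1
  · obtain ⟨k, r⟩ := p
    simp only [blockWeight, blockRotation, Equiv.coe_fn_mk]
    grind
  · rw [Measure.dirac_apply, Measure.dirac_apply]
    rfl

theorem blockMap_preserving (e : ℕ → ℝ) [SFinite (blockMeasure e)] :
    MeasurePreserving blockMap ((blockMeasure e).prod fairSigns)
      ((blockMeasure e).prod fairSigns) := by
  refine (blockMeasure_preserving e).skew_product
    (g := fun p (ω : ℕ → Bool) => if p.2 = 0 then fun i => ω (i + 1) else ω) ?_ ?_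
  · refine measurable_from_prod_countable_right fun p => ?_
    by_cases h : p.2 = 0 <;> simp only [Function.uncurry, h, if_true, if_false] <;> fun_prop
  · refine .of_forall fun p => ?_
    by_cases h : p.2 = 0
    · simp only [h, if_true]; exact fairSigns_map_shift
    · simp only [h, if_false]; exact Measure.map_id

theorem iterate_blockMap (n : ℕ) : ∀ p : ℕ × ℕ, ∃ q m, ∀ ω : ℕ → Bool,
    blockMap^[n] (p, ω) = (q, fun i => ω (i + m)) := by
  induction n with
  | zero => exact fun p => ⟨p, 0, fun ω => rfl⟩
  | succ n ih =>
    intro p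
    obtain ⟨q, m, h⟩ := ih (blockRotation p)
    by_cases hp : p.2 = 0
    · refine ⟨q, m + 1, fun ω => ?_⟩
      rw [Function.iterate_succ_apply, blockMap]
      simp only [hp, if_true, h]
      rfl
    · refine ⟨q, m, fun ω => ?_⟩
      rw [Function.iterate_succ_apply, blockMap]
      simp only [hp, if_false, h]

theorem iterate_blockMap_of_le {k r n : ℕ} (hr : r ≤ k) (hn : n ≤ r) (ω : ℕ → Bool) :
    blockMap^[n] ((k, r), ω) = ((k, r - n), ω) := by
  induction n with
  | zero => rfl
  | succ n ih =>
    rw [Function.iterate_succ_apply', ih (by omega), blockMap]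
    have h0 : r - n ≠ 0 := by omega
    have h1 : r - n ≤ k := by omega
    simp [blockRotation, h0, h1, Nat.sub_sub]

theorem iterate_blockMap_of_lt {k r n : ℕ} (hr : r ≤ k) (hn : r < n) :
    ∃ q m, m ≠ 0 ∧ ∀ ω : ℕ → Bool, blockMap^[n] ((k, r), ω) = (q, fun i => ω (i + m)) := by
  obtain ⟨l, rfl⟩ : ∃ l, n = l + 1 + r := ⟨n - 1 - r, by omega⟩
  obtain ⟨q, m, h⟩ := iterate_blockMap l (k, k)
  refine ⟨q, m + 1, by omega, fun ω => ?_⟩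
  rw [Function.iterate_add_apply, iterate_blockMap_of_le hr le_rfl, Function.iterate_succ_apply]
  simp only [blockMap, blockRotation, Equiv.coe_fn_mk, Nat.sub_self, if_true]
  exact h _

theorem tsum_ofReal_telescope {f : ℕ → ℝ} (hf : Antitone f) (h0 : Tendsto f atTop (𝓝 0)) (n : ℕ) :
    ∑' i, (if n ≤ i then ENNReal.ofReal (f i - f (i + 1)) else 0) = ENNReal.ofReal (f n) := by
  rw [← ENNReal.summable.sum_add_tsum_nat_add' (k := n), Finset.sum_eq_zero, zero_add]
  · simp only [Nat.le_add_left, if_true]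
    have hs : HasSum (fun i => f (i + n) - f (i + n + 1)) (f n) := by
      rw [hasSum_iff_tendsto_nat_of_nonneg (fun i => sub_nonneg.2 (hf (Nat.le_succ _)))]
      have : ∀ N, ∑ i ∈ Finset.range N, (f (i + n) - f (i + n + 1)) = f n - f (N + n) := by
        intro N
        have := Finset.sum_range_sub' (fun i => f (i + n)) N
        simpa [add_right_comm] using this
      simp only [this]
      simpa using ((tendsto_add_atTop_iff_nat n).2 h0).const_sub (f n)
    rw [← ENNReal.ofReal_tsum_of_nonneg (fun i => sub_nonneg.2 (hf (Nat.le_succ _))) hs.summable,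
      hs.tsum_eq]
  · intro i hi
    rw [if_neg (by simpa using hi)]

theorem tsum_blockWeight {g : ℕ → ℝ} (hlim : Tendsto g atTop (𝓝 0))
    (hconv : Antitone fun n => g n - g (n + 1)) (n : ℕ) :
    ∑' p : ℕ × ℕ, (if n ≤ p.2 then
      blockWeight (fun k => (g k - g (k + 1)) - (g (k + 1) - g (k + 2))) p else 0) =
      ENNReal.ofReal (g n) := by
  have hD : Tendsto (fun n => g n - g (n + 1)) atTop (𝓝 0) := by
    simpa using hlim.sub ((tendsto_add_atTop_iff_nat 1).2 hlim)
  have hg : Antitone g := antitone_nat_of_succ_le fun i => sub_nonneg.1 (hconv.le_of_tendsto hD i)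
  rw [← (Equiv.prodComm ℕ ℕ).tsum_eq, ENNReal.tsum_prod', ← tsum_ofReal_telescope hg hlim n]
  refine tsum_congr fun r => ?_
  by_cases h : n ≤ r
  · simp only [Equiv.prodComm_apply, Prod.swap_prod_mk, h, if_true, blockWeight]
    exact tsum_ofReal_telescope hconv hD r
  · simp [h]

/-- The points whose current sign is positive. -/
def positiveSign : Set ((ℕ × ℕ) × (ℕ → Bool)) := {x | x.2 0 = true}

theorem measurableSet_positiveSign : MeasurableSet positiveSign := by
  have h : Measurable fun x : (ℕ × ℕ) × (ℕ → Bool) => x.2 0 := by fun_prop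
  exact h (measurableSet_singleton true)

theorem prod_fairSigns_apply (e : ℕ → ℝ) {s : Set ((ℕ × ℕ) × (ℕ → Bool))} (hs : MeasurableSet s) :
    (blockMeasure e).prod fairSigns s =
      ∑' p, blockWeight e p * fairSigns (Prod.mk p ⁻¹' s) := by
  rw [Measure.prod_apply hs, blockMeasure, lintegral_sum_measure]
  simp [lintegral_smul_measure, lintegral_dirac]

theorem fairSigns_slice_inter {k r n : ℕ} (hr : r ≤ k) :
    fairSigns (Prod.mk (k, r) ⁻¹' (positiveSign ∩ blockMap^[n] ⁻¹' positiveSign)) =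
      4⁻¹ + if n ≤ r then 4⁻¹ else 0 := by
  by_cases h : n ≤ r
  · have h4 : (4⁻¹ + 4⁻¹ : ENNReal) = 2⁻¹ := by
      rw [← two_mul, show (4 : ENNReal) = 2 * 2 by norm_num,
        ENNReal.mul_inv (by simp) (by simp), ← mul_assoc,
        ENNReal.mul_inv_cancel (by simp) (by simp), one_mul]
    rw [if_pos h, h4, ← fairSigns_single]
    congr 1
    ext ω
    simp [positiveSign, iterate_blockMap_of_le hr h]
  · obtain ⟨q, m, hm, hω⟩ := iterate_blockMap_of_lt hr (not_le.1 h)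
    rw [if_neg h, add_zero, ← fairSigns_pair hm]
    congr 1
    ext ω
    simp [positiveSign, hω]

theorem stmt_5 (a : ℕ → ℝ)
    (hlim : Tendsto (fun n : ℕ => a n) atTop (𝓝 0))
    (hconvex : ∀ n : ℕ, 2 ≤ n → 0 ≤ a (n - 1) + a (n + 1) - 2 * a n)
    (ha1 : a 1 ≤ 1 / 8) :
    ∃ (X : Type) (_ : MeasurableSpace X) (μ : Measure X) (T : X → X),
      IsProbabilityMeasure μ ∧ Measurable T ∧ MeasurePreserving T μ μ ∧
      ∃ A : Set X, MeasurableSet A ∧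
        ∀ n : ℕ, 1 ≤ n → (μ (A ∩ T^[n] ⁻¹' A)).toReal - (μ A).toReal ^ 2 = a n := by
  have hb : Tendsto (fun n => a (n + 1)) atTop (𝓝 0) := (tendsto_add_atTop_iff_nat 1).2 hlim
  have hD : Tendsto (fun n => a (n + 1) - a (n + 2)) atTop (𝓝 0) := by
    simpa using hb.sub ((tendsto_add_atTop_iff_nat 2).2 hlim)
  have hDanti : Antitone fun n => a (n + 1) - a (n + 2) := antitone_nat_of_succ_le fun n => by
    have := hconvex (n + 2) (by omega)
    simp only [Nat.add_succ_sub_one] at this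
    linarith
  have ha : Antitone fun n => a (n + 1) :=
    antitone_nat_of_succ_le fun i => sub_nonneg.1 (hDanti.le_of_tendsto hD i)
  have hpos : ∀ n, 0 ≤ a (n + 1) := fun n => ha.le_of_tendsto hb n
  let g : ℕ → ℝ := fun n => if n = 0 then 1 else 4 * a n
  have hg : Tendsto g atTop (𝓝 0) := by
    rw [← tendsto_add_atTop_iff_nat 1]
    simpa [g] using hb.const_mul 4
  have hconv : Antitone fun n => g n - g (n + 1) := antitone_nat_of_succ_le fun n => by
    rcases n with _ | n
    · have := hpos 1
      simp [g] at this ⊢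
      linarith
    · have := hDanti (Nat.le_succ n)
      simp [g] at this ⊢
      linarith
  have hsum := tsum_blockWeight hg hconv
  set e : ℕ → ℝ := fun k => (g k - g (k + 1)) - (g (k + 1) - g (k + 2))
  have htotal : ∑' p, blockWeight e p = 1 := by simpa [g] using hsum 0
  have : IsProbabilityMeasure (blockMeasure e) := ⟨by
    simpa [blockMeasure, Measure.sum_apply_of_countable] using htotal⟩
  have hT := blockMap_preserving e
  refine ⟨_, inferInstance, (blockMeasure e).prod fairSigns, blockMap, inferInstance,
    hT.measurable, hT, positiveSign, measurableSet_positiveSign, fun n hn => ?_⟩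
  have hA : (blockMeasure e).prod fairSigns positiveSign = 2⁻¹ := by
    rw [prod_fairSigns_apply e measurableSet_positiveSign]
    have : ∀ p : ℕ × ℕ, Prod.mk p ⁻¹' positiveSign = {ω | ω 0 = true} := fun _ => rfl
    simp only [this, fairSigns_single]
    rw [ENNReal.tsum_mul_right, htotal, one_mul]
  have hAn : (blockMeasure e).prod fairSigns (positiveSign ∩ blockMap^[n] ⁻¹' positiveSign) =
      4⁻¹ + ENNReal.ofReal (g n) * 4⁻¹ := by
    rw [prod_fairSigns_apply e (measurableSet_positiveSign.inter
      (hT.measurable.iterate n measurableSet_positiveSign)), ← hsum n,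
      ← ENNReal.tsum_mul_right]
    have hquarter : ∑' p, blockWeight e p * 4⁻¹ = 4⁻¹ := by
      rw [ENNReal.tsum_mul_right, htotal, one_mul]
    refine Eq.trans ?_ (congrArg (· + _) hquarter)
    rw [← ENNReal.tsum_add]
    refine tsum_congr fun p => ?_
    obtain ⟨k, r⟩ := p
    by_cases hr : r ≤ k
    · rw [fairSigns_slice_inter hr]
      by_cases h : n ≤ r <;> simp [h, mul_add]
    · simp [blockWeight, hr]
  have hgn : g n = 4 * a n := by simp [g]; omega
  have hgpos : 0 ≤ 4 * a n := by
    obtain ⟨m, rfl⟩ := Nat.exists_eq_add_of_le' hn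
    linarith [hpos m]
  rw [hA, hAn, hgn, ENNReal.toReal_add (by simp) (by simp [ENNReal.mul_eq_top]),
    ENNReal.toReal_mul, ENNReal.toReal_ofReal hgpos]
  simp
  ring
end

section
/- Let σ be a symmetric probability measure on the circle 𝕋 = ℝ/ℤ. Then there exist a measure preserving system (X, 𝒳, μ, T) and a set A ∈ 𝒳 such that μ(A ∩ T⁻ⁿA) − μ(A)² = (1/8)·σ̂(n) for every n ≥ 1, where σ̂(n) = ∫ cos(2πnt) dσ(t). -/
open MeasureTheory Filter Topology

open AddCircle

lemma norm_fourier_apply (k : ℤ) (x : AddCircle (1 : ℝ)) : ‖fourier k x‖ = 1 := by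
  rw [fourier_apply, Circle.norm_coe]

/-- The trigonometric polynomial `x ↦ (1 + cos (2πx)) / 2` on the circle, valued in `[0, 1]`. -/
noncomputable def raisedCosine (x : AddCircle (1 : ℝ)) : unitInterval :=
  ⟨(1 + (fourier 1 x).re) / 2, by
    have h := (Complex.abs_re_le_norm (fourier 1 x)).trans_eq (norm_fourier_apply 1 x)
    rw [abs_le] at h
    constructor <;> linarith⟩

lemma coe_raisedCosine (x : AddCircle (1 : ℝ)) :
    (raisedCosine x : ℝ) = (1 + (fourier 1 x).re) / 2 := rfl

@[fun_prop]
lemma continuous_raisedCosine : Continuous raisedCosine := by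
  unfold raisedCosine
  fun_prop

lemma integrable_of_continuous_addCircle (ρ : Measure (AddCircle (1 : ℝ))) [IsFiniteMeasure ρ]
    {E : Type*} [NormedAddCommGroup E] {g : AddCircle (1 : ℝ) → E}
    (hg : Continuous g) : Integrable g ρ :=
  hg.integrable_of_hasCompactSupport (HasCompactSupport.of_compactSpace g)

lemma integral_re_fourier_mul {k : ℤ} (hk : k ≠ 0) (w : ℂ) :
    ∫ x : AddCircle (1 : ℝ), (fourier k x * w).re ∂haarAddCircle = 0 :=
  integral_eq_zero_of_add_right_eq_neg (g := ((1 / 2 / k : ℝ) : AddCircle (1 : ℝ))) fun x => by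
    rw [fourier_add_half_inv_index hk one_pos, neg_mul, Complex.neg_re]

lemma integral_raisedCosine :
    ∫ x, (raisedCosine x : ℝ) ∂haarAddCircle = 1 / 2 := by
  have h := integral_re_fourier_mul one_ne_zero 1
  simp only [mul_one] at h
  simp_rw [coe_raisedCosine]
  rw [integral_div, integral_add (integrable_const _)
    (integrable_of_continuous_addCircle _ (by fun_prop)), h]
  simp

lemma fourier_apply_add (k : ℤ) (x y : AddCircle (1 : ℝ)) :
    fourier k (x + y) = fourier k x * fourier k y := by
  simp [fourier_apply, toCircle_add]

lemma integral_raisedCosine_mul_add (s : AddCircle (1 : ℝ)) :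
    ∫ x, (raisedCosine x : ℝ) * raisedCosine (x + s) ∂haarAddCircle
      = 1 / 4 + 1 / 8 * (fourier 1 s).re := by
  have expand (x : AddCircle (1 : ℝ)) : (raisedCosine x : ℝ) * raisedCosine (x + s)
      = (1 / 4 + 1 / 8 * (fourier 1 s).re)
        + ((fourier 1 x * ((1 + fourier 1 s) / 4)).re
          + (fourier 2 x * (fourier 1 s / 8)).re) := by
    have hnorm : (fourier 1 x).re ^ 2 + (fourier 1 x).im ^ 2 = 1 := by
      rw [← Complex.sq_norm_sub_sq_re, norm_fourier_apply]
      ring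
    have h2 : fourier 2 x = fourier 1 x * fourier 1 x := fourier_add (m := 1) (n := 1)
    have h4 (z : ℂ) : z / 4 = ((1 / 4 : ℝ) : ℂ) * z := by push_cast; ring
    have h8 (z : ℂ) : z / 8 = ((1 / 8 : ℝ) : ℂ) * z := by push_cast; ring
    rw [coe_raisedCosine, coe_raisedCosine, fourier_apply_add, h2, h4, h8]
    generalize fourier 1 x = e at *
    generalize fourier 1 s = w at *
    simp only [Complex.mul_re, Complex.mul_im, Complex.ofReal_re, Complex.ofReal_im,
      Complex.add_re, Complex.add_im, Complex.one_re, Complex.one_im]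
    linear_combination (w.re / 8) * hnorm
  simp_rw [expand]
  generalize 1 / 4 + 1 / 8 * (fourier 1 s).re = c
  rw [integral_add (integrable_const c)
      (integrable_of_continuous_addCircle _ (by fun_prop)),
    integral_add (integrable_of_continuous_addCircle _ (by fun_prop))
      (integrable_of_continuous_addCircle _ (by fun_prop)),
    integral_re_fourier_mul one_ne_zero, integral_re_fourier_mul two_ne_zero]
  simp

/-- The law of a sequence of independent uniform variables in `[0, 1]`. -/
noncomputable abbrev iidUniform : Measure (ℕ → unitInterval) :=
  Measure.infinitePi fun _ => volume

lemma iidUniform_le (i : ℕ) (a : unitInterval) :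
    iidUniform {u | u i ≤ a} = ENNReal.ofReal a := by
  rw [← unitInterval.volume_Iic a,
    ← Measure.infinitePi_map_eval (fun _ : ℕ => (volume : Measure unitInterval)) i,
    Measure.map_apply (by fun_prop) measurableSet_Iic]
  rfl

lemma iidUniform_le_and_le {i j : ℕ} (hij : i ≠ j) (a b : unitInterval) :
    iidUniform {u | u i ≤ a ∧ u j ≤ b} = ENNReal.ofReal (a * b) := by
  rw [ENNReal.ofReal_mul a.2.1, ← unitInterval.volume_Iic a, ← unitInterval.volume_Iic b,
    ← Measure.prod_prod,
    ← Measure.infinitePi_map_eval_prod (P := fun _ : ℕ => (volume : Measure unitInterval)) hij,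
    Measure.map_apply (by fun_prop) (measurableSet_Iic.prod measurableSet_Iic)]
  rfl

/-- The skew product `(t, x) ↦ (t, x + t)` times the one-sided shift. -/
def skewShift (p : AddCircle (1 : ℝ) × AddCircle (1 : ℝ) × (ℕ → unitInterval)) :
    AddCircle (1 : ℝ) × AddCircle (1 : ℝ) × (ℕ → unitInterval) :=
  (p.1, p.2.1 + p.1, fun k => p.2.2 (k + 1))

lemma skewShift_iterate (n : ℕ)
    (p : AddCircle (1 : ℝ) × AddCircle (1 : ℝ) × (ℕ → unitInterval)) :
    skewShift^[n] p = (p.1, p.2.1 + n • p.1, fun k => p.2.2 (k + n)) := by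
  induction n with
  | zero => simp
  | succ n ih =>
    rw [Function.iterate_succ_apply', ih]
    simp only [skewShift, succ_nsmul, add_assoc, add_comm 1 n]

lemma measurePreserving_skewShift (σ : Measure (AddCircle (1 : ℝ))) [IsProbabilityMeasure σ] :
    MeasurePreserving skewShift (σ.prod (haarAddCircle.prod iidUniform))
      (σ.prod (haarAddCircle.prod iidUniform)) := by
  refine (MeasurePreserving.id σ).skew_product
    
    (g := fun t (q : AddCircle (1 : ℝ) × (ℕ → unitInterval)) =>
      (q.1 + t, fun k => q.2 (k + 1)))
    (by fun_prop) (ae_of_all _ fun t => ?_)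
  have hshift : MeasurePreserving (fun (u : ℕ → unitInterval) k => u (k + 1))
      iidUniform iidUniform :=
    ⟨by fun_prop, Measure.map_infinitePi_infinitePi_of_inj (add_left_injective 1)⟩
  exact ((measurePreserving_add_right haarAddCircle t).prod hshift).map_eq

/-- The points whose zeroth coordinate in `[0, 1]` lies below the value of `raisedCosine`. -/
def subgraphSet : Set (AddCircle (1 : ℝ) × AddCircle (1 : ℝ) × (ℕ → unitInterval)) :=
  {p | p.2.2 0 ≤ raisedCosine p.2.1}

lemma measurableSet_subgraphSet : MeasurableSet subgraphSet :=
  measurableSet_le (by fun_prop) (continuous_raisedCosine.measurable.comp (by fun_prop))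

lemma measure_subgraphSet (σ : Measure (AddCircle (1 : ℝ))) [IsProbabilityMeasure σ] :
    σ.prod (haarAddCircle.prod iidUniform) subgraphSet = ENNReal.ofReal (1 / 2) := by
  rw [Measure.prod_apply measurableSet_subgraphSet]
  have h (t : AddCircle (1 : ℝ)) :
      haarAddCircle.prod iidUniform (Prod.mk t ⁻¹' subgraphSet) = ENNReal.ofReal (1 / 2) := by
    rw [Measure.prod_apply (measurable_prodMk_left measurableSet_subgraphSet),
      ← integral_raisedCosine, ofReal_integral_eq_lintegral_ofReal
        (integrable_of_continuous_addCircle _ (by fun_prop))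
        (ae_of_all _ fun x => (raisedCosine x).2.1)]
    exact lintegral_congr fun x => iidUniform_le 0 (raisedCosine x)
  simp_rw [h]
  simp

lemma measure_subgraphSet_inter (σ : Measure (AddCircle (1 : ℝ))) [IsProbabilityMeasure σ]
    {n : ℕ} (hn : n ≠ 0) :
    σ.prod (haarAddCircle.prod iidUniform) (subgraphSet ∩ skewShift^[n] ⁻¹' subgraphSet)
      = ENNReal.ofReal (1 / 4 + 1 / 8 * ∫ t, (fourier (n : ℤ) t).re ∂σ) := by
  have hmeas : MeasurableSet (subgraphSet ∩ skewShift^[n] ⁻¹' subgraphSet) :=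
    measurableSet_subgraphSet.inter
      ((measurePreserving_skewShift σ).measurable.iterate n measurableSet_subgraphSet)
  have hint : Integrable (fun t => 1 / 8 * (fourier (n : ℤ) t).re) σ :=
    integrable_of_continuous_addCircle _ (by fun_prop)
  have hslice (t : AddCircle (1 : ℝ)) : 1 / 4 + 1 / 8 * (fourier (n : ℤ) t).re
      = ∫ x, (raisedCosine x : ℝ) * raisedCosine (x + n • t) ∂haarAddCircle := by
    rw [integral_raisedCosine_mul_add]
    simp [fourier_apply]
  have hnonneg (t x : AddCircle (1 : ℝ)) : 0 ≤ (raisedCosine x : ℝ) * raisedCosine (x + n • t) :=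
    mul_nonneg (raisedCosine x).2.1 (raisedCosine _).2.1
  have hsum : 1 / 4 + 1 / 8 * ∫ t, (fourier (n : ℤ) t).re ∂σ
      = ∫ t, (1 / 4 + 1 / 8 * (fourier (n : ℤ) t).re) ∂σ := by
    rw [integral_add (integrable_const _) hint, integral_const_mul]
    simp
  rw [Measure.prod_apply hmeas, hsum, ofReal_integral_eq_lintegral_ofReal
    (integrable_of_continuous_addCircle _ (by fun_prop))
    (ae_of_all _ fun t => by
      simp only [hslice]
      exact integral_nonneg (hnonneg t))]
  refine lintegral_congr fun t => ?_
  rw [Measure.prod_apply (measurable_prodMk_left hmeas), hslice,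
    ofReal_integral_eq_lintegral_ofReal
      (integrable_of_continuous_addCircle _ (by fun_prop)) (ae_of_all _ (hnonneg t))]
  refine lintegral_congr fun x => ?_
  rw [← iidUniform_le_and_le hn.symm]
  congr 1
  ext u
  simp [subgraphSet, skewShift_iterate]

theorem stmt_6 (σ : Measure (AddCircle (1 : ℝ))) [IsProbabilityMeasure σ]
    (hsymm : σ.map (fun t => -t) = σ) :
    ∃ (X : Type) (_ : MeasurableSpace X) (μ : Measure X) (T : X → X),
      IsProbabilityMeasure μ ∧ Measurable T ∧ MeasurePreserving T μ μ ∧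
      ∃ A : Set X, MeasurableSet A ∧
        ∀ n : ℕ, 1 ≤ n →
          (μ (A ∩ T^[n] ⁻¹' A)).toReal - (μ A).toReal ^ 2
            = (1 / 8) * ∫ t, (fourier (n : ℤ) t).re ∂σ := by
  refine ⟨_, inferInstance, σ.prod (haarAddCircle.prod iidUniform), skewShift, inferInstance,
    (measurePreserving_skewShift σ).measurable, measurePreserving_skewShift σ,
    subgraphSet, measurableSet_subgraphSet, fun n hn => ?_⟩
  have hbound : -1 ≤ ∫ t, (fourier (n : ℤ) t).re ∂σ := by
    have h : ‖∫ t, (fourier (n : ℤ) t).re ∂σ‖ ≤ 1 * σ.real Set.univ :=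
      norm_integral_le_of_norm_le_const (ae_of_all _ fun t =>
        (Complex.abs_re_le_norm (fourier (n : ℤ) t)).trans_eq (norm_fourier_apply n t))
    simp only [probReal_univ, mul_one, Real.norm_eq_abs] at h
    exact (abs_le.mp h).1
  rw [measure_subgraphSet, measure_subgraphSet_inter σ (by lia),
    ENNReal.toReal_ofReal (by linarith), ENNReal.toReal_ofReal (by norm_num)]
  ring
end

section
/- For any partition ℕ = S₊ ∪ S₋ there exists a set E ⊆ ℕ such that the density d(E) exists, the density d(E ∩ (E − n)) exists for every n ≥ 1, and: (i) d(E ∩ (E − n)) > d(E)² for every n ∈ S₊; (ii) d(E ∩ (E − n)) < d(E)² for every n ∈ S₋; (iii) lim_{n→∞} d(E ∩ (E − n)) = d(E)². -/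
open Filter Topology

/-- `E ⊆ ℕ` has (natural) density `δ` if `|E ∩ {1,…,N}| / N → δ`. -/
def HasDensity (E : Set ℕ) (δ : ℝ) : Prop :=
  Tendsto (fun N : ℕ => (Nat.card ↥(E ∩ Set.Icc 1 N) : ℝ) / N) atTop (𝓝 δ)

open MeasureTheory ProbabilityTheory

theorem tendsto_div_of_tendsto_div_sq {s : ℕ → ℝ} (hs : ∀ n, |s (n + 1) - s n| ≤ 1)
    (h : Tendsto (fun k : ℕ => s (k ^ 2) / (k : ℝ) ^ 2) atTop (𝓝 0)) :
    Tendsto (fun n : ℕ => s n / n) atTop (𝓝 0) := by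
  have hd : ∀ a b : ℕ, |s (a + b) - s a| ≤ b := by
    intro a b
    induction b with
    | zero => simp
    | succ b ih =>
      have h1 := hs (a + b)
      have h2 : s (a + (b + 1)) - s a = (s (a + b + 1) - s (a + b)) + (s (a + b) - s a) := by
        rw [← add_assoc]; ring
      rw [h2]
      push_cast
      linarith [abs_add_le (s (a + b + 1) - s (a + b)) (s (a + b) - s a)]
  have hsqrt : Tendsto Nat.sqrt atTop atTop :=
    tendsto_atTop_mono' _ (eventually_atTop.2 ⟨0, fun n _ => le_rfl⟩)
      (tendsto_atTop.2 fun b => eventually_atTop.2 ⟨b * b, fun n hn => Nat.le_sqrt.2 hn⟩)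
  have hg : Tendsto (fun k : ℕ => |s (k ^ 2) / (k : ℝ) ^ 2| + 2 / (k : ℝ)) atTop (𝓝 0) := by
    simpa using h.abs.add (tendsto_const_div_atTop_nhds_zero_nat 2)
  refine squeeze_zero_norm' ?_ (hg.comp hsqrt)
  filter_upwards [eventually_ge_atTop 1] with n hn
  set k := Nat.sqrt n with hk
  have hk1 : 1 ≤ k := Nat.le_sqrt.2 (by simpa using hn)
  have hle : k ^ 2 ≤ n := by simpa [sq] using Nat.sqrt_le n
  have hlt : n ≤ k ^ 2 + 2 * k := by
    have := Nat.sqrt_le_add n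
    rw [← hk] at this
    nlinarith
  obtain ⟨b, hnb⟩ := Nat.exists_eq_add_of_le hle
  have hb : b ≤ 2 * k := by omega
  have hkR : (1 : ℝ) ≤ k := by exact_mod_cast hk1
  have hbR : (b : ℝ) ≤ 2 * k := by exact_mod_cast hb
  have h1 : |s (k ^ 2 + b)| ≤ |s (k ^ 2)| + 2 * k := by
    have := hd (k ^ 2) b
    have h3 := abs_sub_abs_le_abs_sub (s (k ^ 2 + b)) (s (k ^ 2))
    linarith
  have hpos : (0 : ℝ) < (k : ℝ) ^ 2 := by positivity
  simp only [Function.comp, ← hk, Real.norm_eq_abs, abs_div, Nat.abs_cast, abs_pow]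
  have h2 : |s (k ^ 2)| / (k : ℝ) ^ 2 + 2 / (k : ℝ) = (|s (k ^ 2)| + 2 * k) / (k : ℝ) ^ 2 := by
    field_simp
  rw [h2, hnb]
  push_cast
  gcongr
  exact le_add_of_nonneg_right b.cast_nonneg

theorem integral_prod_eq_zero {Ω : Type*} [MeasurableSpace Ω] {μ : Measure Ω}
    {ξ : ℕ → Ω → ℝ} (hm : ∀ i, Measurable (ξ i)) (hi : iIndepFun ξ μ)
    (h0 : ∀ i, ∫ ω, ξ i ω ∂μ = 0) {S : Finset ℕ} (hS : S.Nonempty) :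
    ∫ ω, ∏ i ∈ S, ξ i ω ∂μ = 0 := by
  have h := (hi.precomp (g := fun i : S => (i : ℕ)) Subtype.val_injective)
  have h1 := h.integral_fun_prod_eq_prod_integral fun i => (hm i).aestronglyMeasurable
  have h2 : ∀ ω, ∏ i ∈ S, ξ i ω = ∏ i : S, ξ i ω := fun ω => (Finset.prod_coe_sort S (ξ · ω)).symm
  simp only [h2]
  rw [h1]
  obtain ⟨i, hi⟩ := hS
  exact Finset.prod_eq_zero (Finset.mem_univ ⟨i, hi⟩) (h0 i)

section

variable {Ω : Type*} [MeasurableSpace Ω] {μ : Measure Ω} [IsProbabilityMeasure μ]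

theorem ae_tendsto_average_zero {f : ℕ → Ω → ℝ} (hf : ∀ n, Measurable (f n))
    (hb : ∀ n ω, |f n ω| ≤ 1) {C : ℝ}
    (hC : ∀ N : ℕ, ∫ ω, (∑ n ∈ Finset.range N, f n ω) ^ 2 ∂μ ≤ C * N) :
    ∀ᵐ ω ∂μ, Tendsto (fun N : ℕ => (∑ n ∈ Finset.range N, f n ω) / N) atTop (𝓝 0) := by
  set G : ℕ → Ω → ℝ := fun k ω => ((∑ n ∈ Finset.range (k ^ 2), f n ω) / (k : ℝ) ^ 2) ^ 2 with hG
  have hGm : ∀ k, Measurable (G k) := fun k =>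
    ((Finset.measurable_sum _ fun n _ => hf n).div_const _).pow_const _
  have hsum : ∀ N ω, |∑ n ∈ Finset.range N, f n ω| ≤ N := fun N ω =>
    (Finset.abs_sum_le_sum_abs _ _).trans <| by
      simpa using Finset.sum_le_sum fun n (_ : n ∈ Finset.range N) => hb n ω
  have hGi : ∀ k, Integrable (G k) μ := fun k => by
    refine Integrable.of_bound (hGm k).aestronglyMeasurable 1 (ae_of_all _ fun ω => ?_)
    rw [Real.norm_eq_abs, hG, abs_pow, abs_div]
    refine pow_le_one₀ (by positivity) ?_
    refine div_le_one_of_le₀ ?_ (abs_nonneg _)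
    rw [abs_of_nonneg (by positivity : (0 : ℝ) ≤ (k : ℝ) ^ 2)]
    exact_mod_cast hsum (k ^ 2) ω
  have hGint : ∀ k, ∫ ω, G k ω ∂μ ≤ C * (1 / (k : ℝ) ^ 2) := fun k => by
    simp only [hG, div_pow, integral_div]
    rcases Nat.eq_zero_or_pos k with rfl | hk
    · simp
    have hk' : (0 : ℝ) < k := by exact_mod_cast hk
    have := hC (k ^ 2)
    rw [div_le_iff₀ (by positivity)]
    refine this.trans (le_of_eq ?_)
    push_cast
    field_simp
  have hfin : ∫⁻ ω, ∑' k, ENNReal.ofReal (G k ω) ∂μ ≠ ⊤ := by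
    rw [lintegral_tsum fun k => (hGm k).ennreal_ofReal.aemeasurable]
    have h1 : ∀ k, ∫⁻ ω, ENNReal.ofReal (G k ω) ∂μ = ENNReal.ofReal (∫ ω, G k ω ∂μ) := fun k =>
      (ofReal_integral_eq_lintegral_ofReal (hGi k) (ae_of_all _ fun ω => sq_nonneg _)).symm
    simp only [h1]
    have hs : Summable fun k => ∫ ω, G k ω ∂μ :=
      Summable.of_nonneg_of_le (fun k => integral_nonneg fun ω => sq_nonneg _) hGint
        ((Real.summable_one_div_nat_pow.2 one_lt_two).mul_left C)
    exact hs.tsum_ofReal_ne_top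
  have hae := ae_lt_top (Measurable.tsum fun k => (hGm k).ennreal_ofReal) hfin
  filter_upwards [hae] with ω hω
  refine tendsto_div_of_tendsto_div_sq (s := fun N => ∑ n ∈ Finset.range N, f n ω) ?_ ?_
  · intro n
    simpa [Finset.sum_range_succ] using hb n ω
  · have h0 := ENNReal.tendsto_atTop_zero_of_tsum_ne_top hω.ne
    have h1 : Tendsto (fun k => G k ω) atTop (𝓝 0) := by
      have h2 := (ENNReal.tendsto_toReal ENNReal.zero_ne_top).comp h0
      simpa [Function.comp_def, ENNReal.toReal_ofReal, hG, sq_nonneg, ENNReal.toReal_ofReal']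
        using h2
    have h3 := h1.sqrt
    simp only [hG, Real.sqrt_sq_eq_abs, Real.sqrt_zero] at h3
    exact (tendsto_zero_iff_abs_tendsto_zero _).2 h3

theorem prod_mul_prod_eq_prod_symmDiff {x : ℕ → ℝ} (hx : ∀ i, x i * x i = 1) (S T : Finset ℕ) :
    (∏ i ∈ S, x i) * ∏ i ∈ T, x i = ∏ i ∈ symmDiff S T, x i := by
  rw [symmDiff_def, Finset.sup_eq_union, Finset.prod_union disjoint_sdiff_sdiff,
    ← Finset.prod_inter_mul_prod_sdiff S T, ← Finset.prod_inter_mul_prod_sdiff T S,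
    Finset.inter_comm T S]
  have h : (∏ i ∈ S ∩ T, x i) * ∏ i ∈ S ∩ T, x i = 1 := by
    rw [← Finset.prod_mul_distrib]
    exact Finset.prod_eq_one fun i _ => hx i
  linear_combination ((∏ i ∈ S \ T, x i) * ∏ i ∈ T \ S, x i) * h

theorem ae_tendsto_average_walsh {ξ : ℕ → Ω → ℝ} (hm : ∀ i, Measurable (ξ i))
    (hi : iIndepFun ξ μ) (h0 : ∀ i, ∫ ω, ξ i ω ∂μ = 0) (hξ : ∀ i ω, ξ i ω = 1 ∨ ξ i ω = -1)
    {c : ℕ → ℝ} (hc : ∀ n, |c n| ≤ 1) {S : ℕ → Finset ℕ} {C : ℕ}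
    (hC : ∀ n N, ((Finset.range N).filter fun k => S n = S k).card ≤ C) :
    ∀ᵐ ω ∂μ, Tendsto (fun N : ℕ => (∑ n ∈ Finset.range N, c n * ∏ i ∈ S n, ξ i ω) / N)
      atTop (𝓝 0) := by
  have habs : ∀ (T : Finset ℕ) ω, |∏ i ∈ T, ξ i ω| = 1 := fun T ω => by
    rw [Finset.abs_prod]
    exact Finset.prod_eq_one fun i _ => by rcases hξ i ω with h | h <;> simp [h]
  have hsq : ∀ ω i, ξ i ω * ξ i ω = 1 := fun ω i => by rcases hξ i ω with h | h <;> simp [h]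
  have hpm : ∀ T : Finset ℕ, Measurable fun ω => ∏ i ∈ T, ξ i ω := fun T =>
    Finset.measurable_prod _ fun i _ => hm i
  have hint : ∀ T : Finset ℕ, Integrable (fun ω => ∏ i ∈ T, ξ i ω) μ := fun T =>
    Integrable.of_bound (hpm T).aestronglyMeasurable 1
      (ae_of_all _ fun ω => by rw [Real.norm_eq_abs, habs])
  refine ae_tendsto_average_zero (C := C) (fun n => (hpm _).const_mul _) ?_ ?_
  · intro n ω
    rw [abs_mul, habs, mul_one]
    exact hc n
  · intro N
    have hexp : ∀ ω, (∑ n ∈ Finset.range N, c n * ∏ i ∈ S n, ξ i ω) ^ 2 =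
        ∑ n ∈ Finset.range N, ∑ k ∈ Finset.range N,
          c n * c k * ∏ i ∈ symmDiff (S n) (S k), ξ i ω := fun ω => by
      rw [sq, Finset.sum_mul_sum]
      refine Finset.sum_congr rfl fun n _ => Finset.sum_congr rfl fun k _ => ?_
      rw [← prod_mul_prod_eq_prod_symmDiff (hsq ω)]
      ring
    simp only [hexp]
    rw [integral_finsetSum _ fun n _ => integrable_finsetSum _ fun k _ => (hint _).const_mul _]
    have hn : ∀ n ∈ Finset.range N, (∫ ω, ∑ k ∈ Finset.range N,
        c n * c k * ∏ i ∈ symmDiff (S n) (S k), ξ i ω ∂μ) ≤ C := by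
      intro n _
      rw [integral_finsetSum _ fun k _ => (hint _).const_mul _]
      have hk : ∀ k ∈ Finset.range N,
          (∫ ω, c n * c k * ∏ i ∈ symmDiff (S n) (S k), ξ i ω ∂μ) ≤
            if S n = S k then 1 else 0 := by
        intro k _
        rw [integral_const_mul]
        split_ifs with h
        · simp only [h, symmDiff_self, Finset.bot_eq_empty, Finset.prod_empty, integral_const,
            probReal_univ, smul_eq_mul, mul_one]
          refine (le_abs_self _).trans ?_
          rw [abs_mul]
          exact mul_le_one₀ (hc n) (abs_nonneg _) (hc k)
        · rw [integral_prod_eq_zero hm hi h0 (Finset.nonempty_iff_ne_empty.2 fun h' =>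
            h (symmDiff_eq_bot.1 h')), mul_zero]
      refine (Finset.sum_le_sum hk).trans ?_
      rw [Finset.sum_boole]
      exact_mod_cast hC n N
    refine (Finset.sum_le_sum hn).trans (le_of_eq ?_)
    simp [mul_comm]

end

theorem exists_rademacher : ∃ (Ω : Type) (_ : MeasurableSpace Ω) (μ : Measure Ω)
    (ξ : ℕ → Ω → ℝ), IsProbabilityMeasure μ ∧ (∀ i, Measurable (ξ i)) ∧ iIndepFun ξ μ ∧
      (∀ i, ∫ ω, ξ i ω ∂μ = 0) ∧ ∀ i ω, ξ i ω = 1 ∨ ξ i ω = -1 := by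
  let ν : Measure Bool := (PMF.uniformOfFintype Bool).toMeasure
  let g : Bool → ℝ := fun b => if b then 1 else -1
  have hg : Measurable g := measurable_of_finite g
  refine ⟨ℕ → Bool, inferInstance, Measure.infinitePi fun _ => ν, fun i ω => g (ω i),
    inferInstance, fun i => hg.comp (measurable_pi_apply i),
    iIndepFun_infinitePi fun _ => hg, fun i => ?_, fun i ω => ?_⟩
  · have hmp := measurePreserving_eval_infinitePi (fun _ : ℕ => ν) i
    have h1 := integral_map (μ := Measure.infinitePi fun _ : ℕ => ν)
      hmp.measurable.aemeasurable (f := g) hg.aestronglyMeasurable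
    rw [hmp.map_eq] at h1
    simp only [Function.eval] at h1
    rw [← h1, PMF.integral_eq_sum]
    simp [g]
  · by_cases h : ω i <;> simp [g, h]

theorem card_Ico_filter_dvd_sub (v : ℤ) {m k : ℕ} (hk : k ≤ m) :
    ((Finset.Ico (0 : ℤ) (8 ^ m)).filter fun x => (8 : ℤ) ^ k ∣ x - v).card = 8 ^ (m - k) := by
  have h := Int.Ico_filter_modEq_card (0 : ℤ) (8 ^ m) (r := 8 ^ k) (by positivity) v
  have h1 : ((Finset.Ico (0 : ℤ) (8 ^ m)).filter fun x => (8 : ℤ) ^ k ∣ x - v) =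
      (Finset.Ico (0 : ℤ) (8 ^ m)).filter fun x => x ≡ v [ZMOD 8 ^ k] :=
    Finset.filter_congr fun x _ => by rw [Int.modEq_comm, Int.modEq_iff_dvd]
  have h2 : (((8 ^ m : ℤ) - v : ℚ)) / ((8 ^ k : ℤ) : ℚ) =
      ((0 : ℤ) - v : ℚ) / ((8 ^ k : ℤ) : ℚ) + ((8 ^ (m - k) : ℤ) : ℚ) := by
    obtain ⟨d, rfl⟩ := Nat.exists_eq_add_of_le hk
    push_cast
    rw [Nat.add_sub_cancel_left, pow_add]
    field_simp
    ring
  rw [← h1, h2, Int.ceil_add_intCast, add_sub_cancel_left, max_eq_left (by positivity)] at h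
  exact_mod_cast h

theorem sum_four_mul_eight_pow_lt (m : ℕ) :
    ∑ k ∈ Finset.range m, 4 * 8 ^ (m - k) < 8 ^ (m + 1) := by
  induction m with
  | zero => simp
  | succ m ih =>
    rw [Finset.sum_range_succ']
    simp only [Nat.add_sub_add_right, Nat.sub_zero]
    rw [pow_succ 8 (m + 1)]
    omega

theorem exists_avoiding_residue (m : ℕ) (b : Fin m → ℤ) : ∃ x : ℤ, ∀ k : Fin m,
    ¬ (8 : ℤ) ^ (k + 1 : ℕ) ∣ x - b k ∧
    ¬ (8 : ℤ) ^ (k + 1 : ℕ) ∣ x - (b k + (k + 1)) ∧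
    ¬ (8 : ℤ) ^ (k + 1 : ℕ) ∣ x - (b k - (m + 1)) ∧
    ¬ (8 : ℤ) ^ (k + 1 : ℕ) ∣ x - (b k + (k + 1) - (m + 1)) := by
  classical
  by_contra! hcon
  let I := Finset.Ico (0 : ℤ) (8 ^ (m + 1))
  let B : Fin m → ℤ → Finset ℤ := fun k v => I.filter fun x => (8 : ℤ) ^ (k + 1 : ℕ) ∣ x - v
  have hB : ∀ k v, (B k v).card = 8 ^ (m - k) := fun k v => by
    have := card_Ico_filter_dvd_sub v (m := m + 1) (k := k + 1) (by omega)
    simpa only [Nat.add_sub_add_right] using this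
  have hsub : I ⊆ Finset.univ.biUnion fun k : Fin m =>
      ((B k (b k) ∪ B k (b k + (k + 1))) ∪ B k (b k - (m + 1))) ∪
        B k (b k + (k + 1) - (m + 1)) := by
    intro x hx
    obtain ⟨k, hk⟩ := hcon x
    simp only [Finset.mem_biUnion, Finset.mem_univ, true_and, Finset.mem_union, B,
      Finset.mem_filter, hx]
    exact ⟨k, by tauto⟩
  have hcard := (Finset.card_le_card hsub).trans Finset.card_biUnion_le
  have hle : ∀ k : Fin m, (((B k (b k) ∪ B k (b k + (k + 1))) ∪ B k (b k - (m + 1))) ∪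
        B k (b k + (k + 1) - (m + 1))).card ≤ 4 * 8 ^ (m - k : ℕ) := fun k => by
    have h1 := Finset.card_union_le (B k (b k)) (B k (b k + (k + 1)))
    have h2 := Finset.card_union_le (B k (b k) ∪ B k (b k + (k + 1))) (B k (b k - (m + 1)))
    have h3 := Finset.card_union_le ((B k (b k) ∪ B k (b k + (k + 1))) ∪ B k (b k - (m + 1)))
      (B k (b k + (k + 1) - (m + 1)))
    simp only [hB] at h1 h2 h3
    omega
  have h4 := hcard.trans (Finset.sum_le_sum fun k _ => hle k)
  rw [Fin.sum_univ_eq_sum_range (fun k => 4 * 8 ^ (m - k))] at h4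
  have hI : I.card = 8 ^ (m + 1) := by
    simp only [I, Int.card_Ico, sub_zero]
    have : (8 : ℤ) ^ (m + 1) = ((8 ^ (m + 1) : ℕ) : ℤ) := by push_cast; rfl
    rw [this, Int.toNat_natCast]
  rw [hI] at h4
  exact absurd (sum_four_mul_eight_pow_lt m) (not_lt.2 h4)

/-- Residues `a m` such that neither `a m` nor `a m + (m + 1)` is congruent to `a k` or
`a k + (k + 1)` modulo `8 ^ (k + 1)`, for every `k < m`. -/
noncomputable def avoidingResidue (m : ℕ) : ℤ :=
  Classical.choose (exists_avoiding_residue m fun k : Fin m => avoidingResidue k)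
termination_by m
decreasing_by all_goals exact k.isLt

theorem avoidingResidue_spec {k m : ℕ} (h : k < m) :
    ¬ (8 : ℤ) ^ (k + 1) ∣ avoidingResidue m - avoidingResidue k ∧
    ¬ (8 : ℤ) ^ (k + 1) ∣ avoidingResidue m - (avoidingResidue k + (k + 1)) ∧
    ¬ (8 : ℤ) ^ (k + 1) ∣ avoidingResidue m - (avoidingResidue k - (m + 1)) ∧
    ¬ (8 : ℤ) ^ (k + 1) ∣ avoidingResidue m - (avoidingResidue k + (k + 1) - (m + 1)) := by
  have := Classical.choose_spec
    (exists_avoiding_residue m fun k : Fin m => avoidingResidue k) ⟨k, h⟩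
  rw [← avoidingResidue] at this
  exact this

theorem tendsto_card_filter_modEq_div (v : ℕ) {M : ℕ} (hM : 0 < M) :
    Tendsto (fun N : ℕ => (((Finset.range N).filter fun n => n ≡ v [MOD M]).card : ℝ) / N)
      atTop (𝓝 (1 / M)) := by
  have h1 : Tendsto (fun N : ℕ => 1 / (M : ℝ) - 1 / (N : ℝ)) atTop (𝓝 (1 / M)) := by
    simpa using tendsto_const_nhds.sub (tendsto_const_div_atTop_nhds_zero_nat (1 : ℝ))
  have h2 : Tendsto (fun N : ℕ => 1 / (M : ℝ) + 1 / (N : ℝ)) atTop (𝓝 (1 / M)) := by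
    simpa using tendsto_const_nhds.add (tendsto_const_div_atTop_nhds_zero_nat (1 : ℝ))
  have hM' : (0 : ℝ) < M := by exact_mod_cast hM
  have hcount : ∀ N : ℕ, (N : ℝ) / M - 1 ≤
      (((Finset.range N).filter fun n => n ≡ v [MOD M]).card : ℝ) ∧
      (((Finset.range N).filter fun n => n ≡ v [MOD M]).card : ℝ) ≤ (N : ℝ) / M + 1 := by
    intro N
    rw [← Nat.count_eq_card_filter_range, Nat.count_modEq_card N hM v]
    have h3 : N / M * M + N % M = N := Nat.div_add_mod' N M
    have h4 := Nat.mod_lt N hM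
    have h3' : ((N / M : ℕ) : ℝ) * M + (N % M : ℕ) = N := by exact_mod_cast h3
    have h4' : ((N % M : ℕ) : ℝ) < M := by exact_mod_cast h4
    have h5 : (0 : ℝ) ≤ (N % M : ℕ) := Nat.cast_nonneg _
    rw [sub_le_iff_le_add, div_le_iff₀ hM', ← sub_le_iff_le_add, le_div_iff₀ hM']
    split_ifs <;> push_cast <;> constructor <;> nlinarith
  refine tendsto_of_tendsto_of_tendsto_of_le_of_le' h1 h2 ?_ ?_
  · filter_upwards [eventually_gt_atTop 0] with N hN
    have hN' : (0 : ℝ) < N := by exact_mod_cast hN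
    rw [le_div_iff₀ hN']
    refine le_trans (le_of_eq ?_) (hcount N).1
    field_simp
  · filter_upwards [eventually_gt_atTop 0] with N hN
    have hN' : (0 : ℝ) < N := by exact_mod_cast hN
    rw [div_le_iff₀ hN']
    refine (hcount N).2.trans (le_of_eq ?_)
    field_simp

/-- There are disjoint sets `A k` of density `8⁻¹ ^ (k + 1)` whose shifts by `k + 1` are pairwise
disjoint and disjoint from all the `A j`. -/
theorem exists_separated_sets : ∃ A : ℕ → Set ℕ,
    (∀ k, Tendsto (fun N : ℕ => (∑ n ∈ Finset.range N, (A k).indicator (1 : ℕ → ℝ) (n + 1)) / N)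
      atTop (𝓝 (1 / 8 ^ (k + 1)))) ∧
    (∀ j k n, n ∈ A j → n ∈ A k → j = k) ∧
    (∀ j k n, n ∈ A j → n + (j + 1) ∉ A k) ∧
    (∀ j k n n', n ∈ A j → n' ∈ A k → n + (j + 1) = n' + (k + 1) → j = k) := by
  classical
  let a := avoidingResidue
  refine ⟨fun k => {n | (8 : ℤ) ^ (k + 1) ∣ n - a k}, fun k => ?_, ?_, ?_, ?_⟩
  · have hpos : (0 : ℤ) < 8 ^ (k + 1) := by positivity
    have h := tendsto_card_filter_modEq_div ((a k - 1) % 8 ^ (k + 1)).toNat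
      (M := 8 ^ (k + 1)) (by positivity)
    push_cast at h
    refine h.congr fun N => ?_
    congr 1
    rw [Finset.card_filter]
    push_cast
    refine Finset.sum_congr rfl fun n _ => ?_
    rw [Set.indicator_apply]
    refine if_congr ?_ rfl rfl
    rw [Set.mem_ofPred_eq, ← Int.natCast_modEq_iff, Int.toNat_of_nonneg (Int.emod_nonneg _ hpos.ne'),
      Int.modEq_comm, Int.modEq_iff_dvd, ← Int.modEq_iff_dvd]
    push_cast
    rw [← Int.modEq_iff_dvd]
    constructor
    · intro h
      have := ((Int.mod_modEq (a k - 1) (8 ^ (k + 1))).symm.trans h).add_right 1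
      simpa using this
    · intro h
      have := (Int.mod_modEq (a k - 1) (8 ^ (k + 1))).trans (h.sub_right 1)
      simpa using this
  · have key : ∀ j k n, j < k → (8 : ℤ) ^ (j + 1) ∣ n - a j → (8 : ℤ) ^ (k + 1) ∣ n - a k →
        False := fun j k n hjk h1 h2 => by
      have h3 := (pow_dvd_pow (8 : ℤ) (Nat.succ_le_succ hjk.le)).trans h2
      refine (avoidingResidue_spec hjk).1 ?_
      convert Int.dvd_sub h1 h3 using 1
      ring
    intro j k n hj hk
    rcases lt_trichotomy j k with h | h | h
    · exact (key j k n h hj hk).elim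
    · exact h
    · exact (key k j n h hk hj).elim
  · intro j k n hj hk
    simp only [Set.mem_ofPred_eq] at hj hk
    push_cast at hk
    rcases lt_trichotomy j k with h | h | h
    · have h3 := (pow_dvd_pow (8 : ℤ) (Nat.succ_le_succ h.le)).trans hk
      refine (avoidingResidue_spec h).2.1 ?_
      convert Int.dvd_sub hj h3 using 1
      ring
    · subst h
      have h3 : (8 : ℤ) ^ (j + 1) ∣ ((j + 1 : ℕ) : ℤ) := by
        have h4 := Int.dvd_sub hk hj
        rwa [show (n : ℤ) + (j + 1) - a j - (n - a j) = ((j + 1 : ℕ) : ℤ) by push_cast; ring] at h4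
      have h4 := Int.le_of_dvd (by positivity) h3
      have h5 : j + 1 < 8 ^ (j + 1) := Nat.lt_pow_self (by norm_num)
      have h6 : ((j + 1 : ℕ) : ℤ) < 8 ^ (j + 1) := by exact_mod_cast h5
      omega
    · have h3 := (pow_dvd_pow (8 : ℤ) (Nat.succ_le_succ h.le)).trans hj
      refine (avoidingResidue_spec h).2.2.1 ?_
      convert Int.dvd_sub hk h3 using 1
      ring
  · have key : ∀ (j k : ℕ) (n n' : ℤ), j < k → (8 : ℤ) ^ (j + 1) ∣ n - a j →
        (8 : ℤ) ^ (k + 1) ∣ n' - a k → n + (j + 1) = n' + (k + 1) → False := by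
      intro j k n n' hjk h1 h2 he
      have h3 := (pow_dvd_pow (8 : ℤ) (Nat.succ_le_succ hjk.le)).trans h2
      refine (avoidingResidue_spec hjk).2.2.2 ?_
      convert Int.dvd_sub h1 h3 using 1
      linear_combination -he
    intro j k n n' hj hk he
    have he' : (n : ℤ) + (j + 1) = n' + (k + 1) := by exact_mod_cast he
    rcases lt_trichotomy j k with h | h | h
    · exact (key j k n n' h hj hk he').elim
    · exact h
    · exact (key k j n' n h hk hj he'.symm).elim

theorem HasDensity.of_tendsto_average {E : Set ℕ} {δ : ℝ} {g : ℕ → ℝ}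
    (hg : ∀ n, g n = E.indicator 1 (n + 1))
    (h : Tendsto (fun N : ℕ => (∑ n ∈ Finset.range N, g n) / N) atTop (𝓝 δ)) :
    HasDensity E δ := by
  classical
  refine h.congr fun N => ?_
  congr 1
  have h1 : E ∩ Set.Icc 1 N = ↑((Finset.Icc 1 N).filter fun n => n ∈ E) := by
    ext n
    simp
    tauto
  rw [Nat.card_coe_set_eq, h1, Set.ncard_coe_finset, Finset.card_filter, Finset.range_eq_Ico,
    Finset.sum_congr rfl fun n _ => hg n, Finset.sum_Ico_add' (fun n => E.indicator 1 n) 0 N 1]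
  push_cast
  simp only [Set.indicator_apply, Pi.one_apply]
  rfl

theorem exists_root_function (A : ℕ → Set ℕ) (hA : ∀ j k n, n ∈ A j → n ∈ A k → j = k)
    (s : ℕ → ℝ) : ∃ (R : ℕ → ℕ) (e : ℕ → ℝ),
      (∀ k n, n ∈ A k → R n = n + (k + 1) ∧ e n = s k) ∧
      ∀ n, (∀ k, n ∉ A k) → R n = n ∧ e n = 1 := by
  classical
  have h : ∀ n, ∃ p : ℕ × ℝ, (∀ k, n ∈ A k → p.1 = n + (k + 1) ∧ p.2 = s k) ∧
      ((∀ k, n ∉ A k) → p.1 = n ∧ p.2 = 1) := by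
    intro n
    by_cases hn : ∃ k, n ∈ A k
    · obtain ⟨k, hk⟩ := hn
      exact ⟨(n + (k + 1), s k), fun j hj => by rw [hA j k n hj hk]; simp,
        fun h => (h k hk).elim⟩
    · push Not at hn
      exact ⟨(n, 1), fun k hk => (hn k hk).elim, fun _ => ⟨rfl, rfl⟩⟩
  choose p hp using h
  exact ⟨fun n => (p n).1, fun n => (p n).2, fun k n hk => (hp n).1 k hk, fun n hn => (hp n).2 hn⟩

theorem card_filter_eq_le_two {R : ℕ → ℕ} (hR : ∀ n n', n < n' → R n = R n' → n < R n ∧ R n' = n')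
    (N s r : ℕ) : ((Finset.range N).filter fun k => R (k + s) = r).card ≤ 2 := by
  by_contra! h
  obtain ⟨a, ha, b, hb, c, hc, hab, hac, hbc⟩ := Finset.two_lt_card.1 h
  have key : ∀ x y z, x < y → y < z → R (x + s) = r → R (y + s) = r → R (z + s) = r → False := by
    intro x y z hxy hyz hx hy hz
    have h1 := hR (x + s) (y + s) (by omega) (by omega)
    have h2 := hR (y + s) (z + s) (by omega) (by omega)
    omega
  simp only [Finset.mem_filter] at ha hb hc
  have h1 := key a b c
  have h2 := key a c b
  have h3 := key b a c
  have h4 := key b c a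
  have h5 := key c a b
  have h6 := key c b a
  grind

theorem exists_signs_tendsto_average_zero {ι : Type*} [Countable ι] {c : ι → ℕ → ℝ}
    (hc : ∀ i n, |c i n| ≤ 1) {S : ι → ℕ → Finset ℕ} {C : ℕ}
    (hC : ∀ i n N, ((Finset.range N).filter fun k => S i n = S i k).card ≤ C) :
    ∃ x : ℕ → ℝ, (∀ n, x n = 1 ∨ x n = -1) ∧ ∀ i, Tendsto
      (fun N : ℕ => (∑ n ∈ Finset.range N, c i n * ∏ j ∈ S i n, x j) / N) atTop (𝓝 0) := by
  obtain ⟨Ω, _, μ, ξ, _, hm, hi, h0, hξ⟩ := exists_rademacher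
  obtain ⟨ω, hω⟩ := (ae_all_iff.2 fun i =>
    ae_tendsto_average_walsh hm hi h0 hξ (hc i) (hC i)).exists
  exact ⟨fun n => ξ n ω, fun n => hξ n ω, hω⟩

/-- There is a sequence of signs with mean zero whose correlation at lag `k + 1` is
`s k * 8⁻¹ ^ (k + 1)`, for any prescribed signs `s`. -/
theorem exists_signs_with_correlations (s : ℕ → ℝ) (hs : ∀ k, s k = 1 ∨ s k = -1) :
    ∃ X : ℕ → ℝ, (∀ n, X n = 1 ∨ X n = -1) ∧
      (∀ t, Tendsto (fun N : ℕ => (∑ n ∈ Finset.range N, X (n + t)) / N) atTop (𝓝 0)) ∧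
      ∀ k, Tendsto (fun N : ℕ => (∑ n ∈ Finset.range N, X (n + 1) * X (n + 1 + (k + 1))) / N)
        atTop (𝓝 (s k * (1 / 8 ^ (k + 1)))) := by
  classical
  obtain ⟨A, hdens, hA, hA', hA''⟩ := exists_separated_sets
  obtain ⟨R, e, hRA, hR0⟩ := exists_root_function A hA s
  have he : ∀ n, e n = 1 ∨ e n = -1 := fun n => by
    by_cases hn : ∃ k, n ∈ A k
    · obtain ⟨k, hk⟩ := hn
      rw [(hRA k n hk).2]
      exact hs k
    · push Not at hn
      exact Or.inl (hR0 n hn).2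
  have heabs : ∀ n, |e n| = 1 := fun n => by rcases he n with h | h <;> simp [h]
  have hroot : ∀ n n', n < n' → R n = R n' → (∃ k, n ∈ A k ∧ n' = n + (k + 1)) ∧ R n' = n' := by
    intro n n' hlt hR
    by_cases hn : ∃ j, n ∈ A j
    · obtain ⟨j, hj⟩ := hn
      by_cases hn' : ∃ k, n' ∈ A k
      · obtain ⟨k, hk⟩ := hn'
        rw [(hRA j n hj).1, (hRA k n' hk).1] at hR
        have := hA'' j k n n' hj hk hR
        omega
      · push Not at hn'
        rw [(hRA j n hj).1, (hR0 n' hn').1] at hR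
        exact ⟨⟨j, hj, hR.symm⟩, (hR0 n' hn').1⟩
    · push Not at hn
      rw [(hR0 n hn).1] at hR
      by_cases hn' : ∃ k, n' ∈ A k
      · obtain ⟨k, hk⟩ := hn'
        rw [(hRA k n' hk).1] at hR
        omega
      · push Not at hn'
        rw [(hR0 n' hn').1] at hR
        omega
  have hfib := card_filter_eq_le_two (R := R) fun n n' hlt hR => by
    obtain ⟨⟨k, -, hk⟩, h⟩ := hroot n n' hlt hR
    omega
  have hmatch : ∀ k n, R n = R (n + (k + 1)) ↔ n ∈ A k := by
    intro k n
    constructor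
    · intro h
      obtain ⟨⟨j, hj, hjk⟩, -⟩ := hroot n (n + (k + 1)) (by omega) h
      obtain rfl : k = j := by omega
      exact hj
    · intro h
      rw [(hRA k n h).1, (hR0 _ fun j => hA' k j n h).1]
  let c : ℕ ⊕ ℕ → ℕ → ℝ := Sum.elim (fun t n => e (n + t))
    fun k n => if R (n + 1) = R (n + 1 + (k + 1)) then 0 else e (n + 1) * e (n + 1 + (k + 1))
  let S : ℕ ⊕ ℕ → ℕ → Finset ℕ := Sum.elim (fun t n => {R (n + t)})
    fun k n => {R (n + 1), R (n + 1 + (k + 1))}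
  obtain ⟨x, hx, hlim⟩ := exists_signs_tendsto_average_zero (c := c) (S := S) (C := 4)
    (by
      rintro (t | k) n
      · simp [c, heabs]
      · simp only [c, Sum.elim_inr]
        split_ifs <;> simp [abs_mul, heabs])
    (by
      rintro (t | k) n N
      · refine le_trans (Finset.card_le_card ?_) ((hfib N t (R (n + t))).trans (by norm_num))
        intro i hi
        simp only [S, Sum.elim_inl, Finset.mem_filter, Finset.singleton_inj] at hi ⊢
        exact ⟨hi.1, hi.2.symm⟩
      · have h1 := hfib N 1 (R (n + 1))
        have h2 := hfib N 1 (R (n + 1 + (k + 1)))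
        have h3 := Finset.card_union_le
          ((Finset.range N).filter fun i => R (i + 1) = R (n + 1))
          ((Finset.range N).filter fun i => R (i + 1) = R (n + 1 + (k + 1)))
        refine le_trans (Finset.card_le_card ?_) (h3.trans (by omega))
        intro i hi
        replace hi := Finset.mem_filter.1 hi
        simp only [S, Sum.elim_inr] at hi
        simp only [Finset.mem_filter, Finset.mem_union]
        have h4 : R (i + 1) ∈ ({R (n + 1), R (n + 1 + (k + 1))} : Finset ℕ) := by
          rw [hi.2]
          simp
        simp only [Finset.mem_insert, Finset.mem_singleton] at h4
        tauto)
  refine ⟨fun n => e n * x (R n), fun n => ?_, fun t => ?_, fun k => ?_⟩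
  · rcases he n with h | h <;> rcases hx (R n) with h' | h' <;> simp [h, h']
  · simpa [c, S] using hlim (Sum.inl t)
  · have h := (hlim (Sum.inr k)).add ((hdens k).const_mul (s k))
    rw [zero_add] at h
    refine h.congr fun N => ?_
    rw [mul_div_assoc', ← add_div, Finset.mul_sum, ← Finset.sum_add_distrib]
    congr 1
    refine Finset.sum_congr rfl fun n _ => ?_
    simp only [c, S, Sum.elim_inr]
    by_cases hn : R (n + 1) = R (n + 1 + (k + 1))
    · have hk := (hmatch k (n + 1)).1 hn
      have hxx : x (R (n + 1)) * x (R (n + 1)) = 1 := by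
        rcases hx (R (n + 1)) with h' | h' <;> simp [h']
      rw [if_pos hn, ← hn, (hRA k _ hk).2, (hR0 _ fun j => hA' k j _ hk).2,
        Set.indicator_of_mem hk, Pi.one_apply]
      linear_combination - s k * hxx
    · have hk : n + 1 ∉ A k := fun h => hn ((hmatch k (n + 1)).2 h)
      rw [if_neg hn, Set.indicator_of_notMem hk, Finset.prod_pair hn]
      ring

theorem stmt_11 (S : Set ℕ) :
    ∃ (E : Set ℕ) (δ : ℝ) (δ' : ℕ → ℝ),
      HasDensity E δ ∧
      (∀ n : ℕ, 1 ≤ n → HasDensity (E ∩ {m | m + n ∈ E}) (δ' n)) ∧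
      (∀ n : ℕ, 1 ≤ n → n ∈ S → δ' n > δ ^ 2) ∧
      (∀ n : ℕ, 1 ≤ n → n ∉ S → δ' n < δ ^ 2) ∧
      Tendsto δ' atTop (𝓝 (δ ^ 2)) := by
  classical
  let s : ℕ → ℝ := fun k => if k + 1 ∈ S then 1 else -1
  have hs : ∀ k, s k = 1 ∨ s k = -1 := fun k => by
    by_cases h : k + 1 ∈ S <;> simp [s, h]
  obtain ⟨X, hX, hmean, hcorr⟩ := exists_signs_with_correlations s hs
  have hone : Tendsto (fun N : ℕ => (∑ _n ∈ Finset.range N, (1 : ℝ)) / N) atTop (𝓝 1) := by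
    refine tendsto_const_nhds.congr' ?_
    filter_upwards [eventually_gt_atTop 0] with N hN
    have : (N : ℝ) ≠ 0 := by exact_mod_cast hN.ne'
    simp [this]
  refine ⟨{n | X n = 1}, 1 / 2, fun m => (1 / 2) ^ 2 + s (m - 1) * (1 / 8) ^ m / 4,
    ?_, ?_, ?_, ?_, ?_⟩
  · refine HasDensity.of_tendsto_average (g := fun n => (1 + X (n + 1)) / 2) (fun n => ?_) ?_
    · rcases hX (n + 1) with h | h <;> norm_num [Set.indicator_apply, h]
    · have h := (hone.add (hmean 1)).div_const 2
      rw [add_zero] at h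
      refine h.congr fun N => ?_
      rw [← Finset.sum_div, Finset.sum_add_distrib]
      ring
  · intro m hm
    obtain ⟨k, rfl⟩ := Nat.exists_eq_add_of_le' hm
    refine HasDensity.of_tendsto_average
      (g := fun n => (1 + X (n + 1) + X (n + (1 + (k + 1))) + X (n + 1) * X (n + 1 + (k + 1))) / 4)
      (fun n => ?_) ?_
    · rw [← add_assoc n 1 (k + 1)]
      rcases hX (n + 1) with h | h <;> rcases hX (n + 1 + (k + 1)) with h' | h' <;>
        norm_num [Set.indicator_apply, h, h']
    · have h := (((hone.add (hmean 1)).add (hmean (1 + (k + 1)))).add (hcorr k)).div_const 4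
      have h2 : (1 + 0 + 0 + s k * (1 / 8 ^ (k + 1))) / 4 =
          (1 / 2) ^ 2 + s (k + 1 - 1) * (1 / 8) ^ (k + 1) / 4 := by
        rw [Nat.add_sub_cancel, one_div_pow (8 : ℝ)]
        ring
      rw [h2] at h
      refine h.congr fun N => ?_
      rw [← Finset.sum_div, Finset.sum_add_distrib, Finset.sum_add_distrib,
        Finset.sum_add_distrib]
      ring
  · intro m hm hmS
    have h1 : s (m - 1) = 1 := by simp [s, Nat.sub_add_cancel hm, hmS]
    have h2 : (0 : ℝ) < (1 / 8) ^ m := by positivity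
    simp only [h1]
    linarith
  · intro m hm hmS
    have h1 : s (m - 1) = -1 := by simp [s, Nat.sub_add_cancel hm, hmS]
    have h2 : (0 : ℝ) < (1 / 8) ^ m := by positivity
    simp only [h1]
    linarith
  · have h : Tendsto (fun m => s (m - 1) * (1 / 8 : ℝ) ^ m / 4) atTop (𝓝 0) := by
      refine squeeze_zero_norm (fun m => ?_)
        (tendsto_pow_atTop_nhds_zero_of_lt_one (r := (1 / 8 : ℝ)) (by norm_num) (by norm_num))
      have h2 : (0 : ℝ) < (1 / 8) ^ m := by positivity
      have h3 : |s (m - 1)| = 1 := by rcases hs (m - 1) with h | h <;> simp [h]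
      rw [Real.norm_eq_abs, abs_div, abs_mul, h3, abs_of_pos h2,
        abs_of_pos (by norm_num : (0 : ℝ) < 4)]
      linarith
    simpa using tendsto_const_nhds.add h
end
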